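/- There exists an absolute constant β₀ such that for β > β₀ and 0 < λ ≤ 1: if λ ∈ I_h = [e^{−4βh−2β}, e^{−4βh−β}], then every geometric contour γ (not necessarily h-elementary) satisfies W^rn_h(γ) ≤ e^{−(β−4)|γ|}. -/

import Mathlib

open scoped BigOperators
open Filter

noncomputable section

attribute [local instance] Classical.propDecidable

/-! ### Basic geometry of the square lattice -/

/-- Sites of the square lattice `ℤ²`. -/
abbrev Site := ℤ × ℤ

/-- The four unit directions. -/
def dirs : Finset Site := {(1, 0), (-1, 0), (0, 1), (0, -1)}

/-- The box `Λ_n = ⟦-n/2, n/2⟧² ∩ ℤ²`. -/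
def box (n : ℕ) : Finset Site :=
  Finset.Icc (-((n : ℤ) / 2)) ((n : ℤ) / 2) ×ˢ Finset.Icc (-((n : ℤ) / 2)) ((n : ℤ) / 2)

/-- SOS gradient energy of a height function on a domain `V`: each nearest-neighbour
edge with at least one endpoint in `V` contributes the absolute height gradient
(the directed sum below counts internal edges twice, whence the factor `1/2`). -/
def sosEnergy (V : Finset Site) (ψ : Site → ℤ) : ℝ :=
  ∑ v ∈ V, ∑ d ∈ dirs,
    (if v + d ∈ V then (1 : ℝ) / 2 else 1) * |(ψ v : ℝ) - (ψ (v + d) : ℝ)|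

/-- The bulk field term `Σ_{v ∈ V} ψ_v`. -/
def sosField (V : Finset Site) (ψ : Site → ℤ) : ℝ := ∑ v ∈ V, (ψ v : ℝ)

/-- The SOS weight `exp(-β Σ|∇ψ| - λ Σ ψ)`. -/
def sosWt (β lam : ℝ) (V : Finset Site) (ψ : Site → ℤ) : ℝ :=
  Real.exp (-(β * sosEnergy V ψ + lam * sosField V ψ))

/-- The inner boundary `∂_i V`. -/
def innerBdry (V : Finset Site) : Finset Site :=
  V.filter fun v => ∃ d ∈ dirs, v + d ∉ V

/-- The interior `V̊ = V ∖ ∂_i V`. -/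
def interiorSites (V : Finset Site) : Finset Site := V \ innerBdry V

/-- The number of edges `|∂_e V|` between `V` and its complement. -/
def edgeBdryCard (V : Finset Site) : ℕ :=
  ∑ v ∈ V, (dirs.filter fun d => v + d ∉ V).card

/-- Nearest-neighbour adjacency. -/
def adjS (u v : Site) : Prop := v - u ∈ dirs

/-- A set of sites is connected (as a subgraph of `ℤ²`). -/
def connectedIn (S : Set Site) : Prop :=
  ∀ x ∈ S, ∀ y ∈ S,
    Relation.ReflTransGen (fun a b => adjS a b ∧ a ∈ S ∧ b ∈ S) x y

/-- A finite set of sites is simply connected: it is connected and its complement is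
connected. -/
def SimplyConn (V : Finset Site) : Prop :=
  connectedIn (↑V : Set Site) ∧ connectedIn ((↑V : Set Site)ᶜ)

/-! ### SOS measures with a boundary signing -/

/-- A boundary signing value: `+`, `-`, `∅` or free. -/
inductive BSign | plus | minus | zero | free

/-- The constraint imposed at an inner-boundary site by a signing, for boundary height
`h`: `+` forces `≥ h`, `-` forces `≤ h`, `∅` forces `= h`, and `f` forces nothing. -/
def BSign.ok : BSign → ℤ → ℤ → Prop
  | .plus, h, t => h ≤ t
  | .minus, h, t => t ≤ h
  | .zero, h, t => t = h
  | .free, _, _ => True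

/-- Height functions with boundary condition identically `h` outside `V`, floor `0`
on `V` (and no ceiling), compatible with the boundary signing `η` along `∂_i V`. -/
def signedConfigs (V : Finset Site) (η : Site → BSign) (h : ℤ) : Set (Site → ℤ) :=
  {ψ | (∀ x, x ∉ V → ψ x = h) ∧ (∀ v ∈ V, 0 ≤ ψ v) ∧
       ∀ v ∈ innerBdry V, BSign.ok (η v) h (ψ v)}

/-- The partition function `Z_{η,h,V}`. -/
def Zsos (β lam : ℝ) (η : Site → BSign) (h : ℤ) (V : Finset Site) : ℝ :=
  ∑' ψ : Site → ℤ, Set.indicator (signedConfigs V η h) (sosWt β lam V) ψ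

/-- Probability of an event under the SOS measure `μ_{η,h,V}`. -/
def Psos (β lam : ℝ) (η : Site → BSign) (h : ℤ) (V : Finset Site)
    (E : Set (Site → ℤ)) : ℝ :=
  (∑' ψ : Site → ℤ, Set.indicator (signedConfigs V η h ∩ E) (sosWt β lam V) ψ) /
    Zsos β lam η h V

/-! ### Contours -/

/-- A (signed geometric) contour, encoded by the finite set of sites it encloses and its
sign (up/down); the contour itself is the dual circuit `(∂_e Int)^*`. -/
structure Contour where
  int : Finset Site
  up : Bool

/-- The length `|γ|` of a contour: the number of boundary edges of its interior. -/
def Contour.len (γ : Contour) : ℕ := edgeBdryCard γ.int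

/-- A valid contour encloses a nonempty simply-connected set of sites. -/
def Contour.valid (γ : Contour) : Prop :=
  γ.int.Nonempty ∧ connectedIn (↑γ.int : Set Site) ∧ connectedIn ((↑γ.int : Set Site)ᶜ)

/-- The constant boundary signing. -/
def constSign (s : BSign) : Site → BSign := fun _ => s

/-- The `h`-renormalized weight `W^rn_h(γ)`. -/
def Wrn (β lam : ℝ) (h : ℤ) (γ : Contour) : ℝ :=
  if γ.up then
    Real.exp (-β * (γ.len : ℝ)) *
      (Zsos β lam (constSign .plus) (h + 1) γ.int / Zsos β lam (constSign .plus) h γ.int)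
  else
    Real.exp (-β * (γ.len : ℝ)) *
      (Zsos β lam (constSign .minus) (h - 1) γ.int / Zsos β lam (constSign .minus) h γ.int)

/-- The `h`-truncated weight `W^tr_h(γ) = min{W^rn_h(γ), e^{-(β-5)|γ|}}`. -/
def Wtr (β lam : ℝ) (h : ℤ) (γ : Contour) : ℝ :=
  min (Wrn β lam h γ) (Real.exp (-(β - 5) * (γ.len : ℝ)))

/-- The elementary diameter bound `min{λ⁻¹, e^{3β(h+1)}}`. -/
def elemBound (β lam : ℝ) (h : ℤ) : ℝ := min (1 / lam) (Real.exp (3 * β * ((h : ℝ) + 1)))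

/-- A set of sites is `h`-elementary small: the enclosing contour (whose ℓ∞-diameter is
one more than that of the enclosed set) has diameter at most `min{λ⁻¹, e^{3β(h+1)}}`. -/
def elemSet (β lam : ℝ) (h : ℤ) (S : Set Site) : Prop :=
  ∀ x ∈ S, ∀ y ∈ S,
    ((max |x.1 - y.1| |x.2 - y.2| : ℤ) : ℝ) + 1 ≤ elemBound β lam h

/-- A contour is `h`-elementary if `diam(γ) ≤ min{λ⁻¹, e^{3β(h+1)}}`. -/
def IsElem (β lam : ℝ) (h : ℤ) (γ : Contour) : Prop := elemSet β lam h (↑γ.int : Set Site)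

/-- Two finite sets of sites share a (primal, equivalently dual) boundary edge. -/
def shareEdge (A B : Finset Site) : Prop :=
  ∃ v, ∃ d ∈ dirs, (v ∈ A ∧ v + d ∉ A) ∧ ((v ∈ B ∧ v + d ∉ B) ∨ (v + d ∈ B ∧ v ∉ B))

/-- Compatibility of a pair of signed contours: they may not cross, and if they overlap
on an edge their signs agree when nested and differ when mutually external. -/
def compatPair (γ γ' : Contour) : Prop :=
  (γ.int ⊆ γ'.int ∨ γ'.int ⊆ γ.int ∨ Disjoint γ.int γ'.int) ∧
  (shareEdge γ.int γ'.int →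
    ((γ.int ⊆ γ'.int ∨ γ'.int ⊆ γ.int) → γ.up = γ'.up) ∧
    (Disjoint γ.int γ'.int → γ.up ≠ γ'.up))

/-- Admissible renormalized families of signed contours in `U`, compatible with the
boundary signing `η` at reference height `h` (no floor constraint except that no
down-contours are allowed when `h = 0`). -/
def famOK (η : Site → BSign) (h : ℤ) (U : Finset Site) (Γ : Multiset Contour) : Prop :=
  (∀ γ ∈ Γ, Contour.valid γ ∧ γ.int ⊆ U) ∧
  (∀ γ ∈ Γ, ∀ γ' ∈ Γ, compatPair γ γ') ∧
  (∀ v ∈ innerBdry U, ∀ γ ∈ Γ, v ∈ γ.int →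
    (γ.up = true → η v ≠ BSign.minus ∧ η v ≠ BSign.zero) ∧
    (γ.up = false → η v ≠ BSign.plus ∧ η v ≠ BSign.zero)) ∧
  (h = 0 → ∀ γ ∈ Γ, γ.up = true)

/-- The product of weights of a family of contours. -/
def prodW (w : Contour → ℝ) (Γ : Multiset Contour) : ℝ := (Γ.map w).prod

/-- The truncated partition function `Z^tr_{η,h,U}`. -/
def Ztr (β lam : ℝ) (η : Site → BSign) (h : ℤ) (U : Finset Site) : ℝ :=
  Real.exp (-lam * (h : ℝ) * (U.card : ℝ)) *
    ∑' Γ : Multiset Contour, Set.indicator {Γ | famOK η h U Γ} (prodW (Wtr β lam h)) Γ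

/-- The renormalized partition function `Z^rn_{η,h,U}`. -/
def Zrn (β lam : ℝ) (η : Site → BSign) (h : ℤ) (U : Finset Site) : ℝ :=
  Real.exp (-lam * (h : ℝ) * (U.card : ℝ)) *
    ∑' Γ : Multiset Contour, Set.indicator {Γ | famOK η h U Γ} (prodW (Wrn β lam h)) Γ

/-- The renormalized elementary partition function `Z^{rn.el}_{η,h,U}`. -/
def Zrnel (β lam : ℝ) (η : Site → BSign) (h : ℤ) (U : Finset Site) : ℝ :=
  Real.exp (-lam * (h : ℝ) * (U.card : ℝ)) *
    ∑' Γ : Multiset Contour,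
      Set.indicator {Γ | famOK η h U Γ ∧ ∀ γ ∈ Γ, IsElem β lam h γ}
        (prodW (Wrn β lam h)) Γ

/-! ### Elementary restriction of the SOS measure -/

/-- `*`-adjacency (adjacency allowing diagonal steps). -/
def starAdj (u v : Site) : Prop := u ≠ v ∧ |u.1 - v.1| ≤ 1 ∧ |u.2 - v.2| ≤ 1

/-- The `*`-connected component of `x` within `S`. -/
def compStar (S : Set Site) (x : Site) : Set Site :=
  {y | Relation.ReflTransGen (fun a b => starAdj a b ∧ a ∈ S ∧ b ∈ S) x y}

/-- The fill of a set of sites: the set together with all sites whose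
complement-component is finite. -/
def fill (C : Set Site) : Set Site :=
  C ∪ {x | {y | Relation.ReflTransGen (fun a b => adjS a b ∧ a ∉ C ∧ b ∉ C) x y}.Finite}

/-- All outermost contours of the configuration `ψ` (with boundary height `h` on `V`)
are `h`-elementary: every filled deviation component is elementary-small. -/
def allOuterElem (β lam : ℝ) (h : ℤ) (V : Finset Site) (ψ : Site → ℤ) : Prop :=
  ∀ v ∈ V, ψ v ≠ h → elemSet β lam h (fill (compStar {u : Site | u ∈ V ∧ ψ u ≠ h} v))

/-- The elementary partition function `Z^el_{η,h,V}`: the contribution to `Z_{η,h,V}`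
of configurations all of whose outermost contours are `h`-elementary. -/
def Zel (β lam : ℝ) (η : Site → BSign) (h : ℤ) (V : Finset Site) : ℝ :=
  ∑' ψ : Site → ℤ,
    Set.indicator (signedConfigs V η h ∩ {ψ | allOuterElem β lam h V ψ})
      (sosWt β lam V) ψ

/-! ### Truncated free energies and the critical sequence -/

/-- `ftr h` is the truncated free energy `f^tr_h(λ)`: the infinite-volume limit of
`|Λ_n|⁻¹ log Z^tr_{η,h,Λ_n}`, for every boundary signing. -/
def FTRlimit (β : ℝ) (ftr : ℕ → ℝ → ℝ) : Prop :=
  ∀ h : ℕ, ∀ lam : ℝ, 0 < lam → lam ≤ 1 → ∀ η : Site → BSign,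
    Tendsto (fun n => Real.log (Ztr β lam η (h : ℤ) (box n)) / ((box n).card : ℝ))
      atTop (nhds (ftr h lam))

/-- `lamc` is the strictly decreasing sequence `(λ_c^{(k)})_{k≥0}` of critical points,
tending to `0`, at which the truncated free energies `ftr` exchange maximizer. -/
def CritSeq (ftr : ℕ → ℝ → ℝ) (lamc : ℕ → ℝ) : Prop :=
  StrictAnti lamc ∧ (∀ i, 0 < lamc i) ∧ Tendsto lamc atTop (nhds 0) ∧
  (∀ i : ℕ, ∀ lam : ℝ, 0 < lam → lam ≤ 1 → lamc i < lam →
    (i = 0 ∨ lam < lamc (i - 1)) → ∀ j : ℕ, j ≠ i → ftr j lam < ftr i lam) ∧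
  (∀ i : ℕ, ftr (i + 1) (lamc i) = ftr i (lamc i) ∧
    ∀ j : ℕ, j ≠ i → j ≠ i + 1 → ftr j (lamc i) < ftr i (lamc i))

/-- `d(x) = min_k |λ_c^{(k)} - x|`. -/
def dmin (lamc : ℕ → ℝ) (x : ℝ) : ℝ := ⨅ k : ℕ, |lamc k - x|

/-- `d⁺(x) = min{λ_c^{(k)} - x : λ_c^{(k)} > x}`. -/
def dplus (lamc : ℕ → ℝ) (x : ℝ) : ℝ := sInf {y : ℝ | ∃ k, x < lamc k ∧ y = lamc k - x}

/-! ### SOS measures with general boundary conditions (floor 0, no ceiling) -/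

/-- Height functions equal to the boundary condition `φ` off `V` and nonnegative on `V`. -/
def bcConfigs (V : Finset Site) (φ : Site → ℤ) : Set (Site → ℤ) :=
  {ψ | (∀ x, x ∉ V → ψ x = φ x) ∧ ∀ v ∈ V, 0 ≤ ψ v}

/-- The partition function with boundary condition `φ`. -/
def Zbc (β lam : ℝ) (V : Finset Site) (φ : Site → ℤ) : ℝ :=
  ∑' ψ : Site → ℤ, Set.indicator (bcConfigs V φ) (sosWt β lam V) ψ

/-- Probability of an event under the SOS measure `μ_{φ,V}` (floor 0, no ceiling). -/
def Pbc (β lam : ℝ) (V : Finset Site) (φ : Site → ℤ) (E : Set (Site → ℤ)) : ℝ :=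
  (∑' ψ : Site → ℤ, Set.indicator (bcConfigs V φ ∩ E) (sosWt β lam V) ψ) /
    Zbc β lam V φ

/-! ### Glauber dynamics on the box with a ceiling -/

/-- A configuration on `Λ_n` with floor `0` and ceiling `ℓ`. -/
abbrev Cfg (n ℓ : ℕ) := {x : Site // x ∈ box n} → Fin (ℓ + 1)

/-- Extension of a configuration by the zero boundary condition. -/
def cExt {n ℓ : ℕ} (ψ : Cfg n ℓ) : Site → ℤ :=
  fun x => if h : x ∈ box n then ((ψ ⟨x, h⟩ : ℕ) : ℤ) else 0

/-- The weight of a configuration (zero boundary conditions). -/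
def cWt (n ℓ : ℕ) (β lam : ℝ) (ψ : Cfg n ℓ) : ℝ := sosWt β lam (box n) (cExt ψ)

/-- The partition function on `Λ_n` with ceiling `ℓ` and zero boundary conditions. -/
def cZ (n ℓ : ℕ) (β lam : ℝ) : ℝ := ∑ ψ : Cfg n ℓ, cWt n ℓ β lam ψ

/-- The SOS probability measure `μ_{n,λ}` (ceiling `ℓ`, zero boundary conditions). -/
def cPi (n ℓ : ℕ) (β lam : ℝ) (ψ : Cfg n ℓ) : ℝ := cWt n ℓ β lam ψ / cZ n ℓ β lam

/-- Probability of an event under `μ_{n,λ}`. -/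
def cProb (n ℓ : ℕ) (β lam : ℝ) (E : Set (Cfg n ℓ)) : ℝ :=
  (∑ ψ : Cfg n ℓ, if ψ ∈ E then cWt n ℓ β lam ψ else 0) / cZ n ℓ β lam

/-- The Glauber (heat-bath) jump rate from `ψ` to `ψ' ≠ ψ`: nonzero only if they differ
at a single site `v` by exactly one, in which case `v`'s height is resampled among
`{ψ_v - 1, ψ_v, ψ_v + 1}` (truncated at the floor and the ceiling) according to the
conditional probabilities given the other heights. -/
def glRate (n ℓ : ℕ) (β lam : ℝ) (ψ ψ' : Cfg n ℓ) : ℝ :=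
  if ψ = ψ' then 0
  else
    ∑ v : {x : Site // x ∈ box n},
      if (∀ u, u ≠ v → ψ u = ψ' u) ∧ (((ψ' v : ℕ) : ℤ) - ((ψ v : ℕ) : ℤ)) ^ 2 = 1 then
        cWt n ℓ β lam ψ' /
          ∑ t : Fin (ℓ + 1),
            (if (((t : ℕ) : ℤ) - ((ψ v : ℕ) : ℤ)) ^ 2 ≤ 1 then
              cWt n ℓ β lam (Function.update ψ v t) else 0)
      else 0

/-- Mean of an observable under `μ_{n,λ}`. -/
def cMean (n ℓ : ℕ) (β lam : ℝ) (f : Cfg n ℓ → ℝ) : ℝ :=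
  ∑ ψ : Cfg n ℓ, cPi n ℓ β lam ψ * f ψ

/-- Variance of an observable under `μ_{n,λ}`. -/
def cVar (n ℓ : ℕ) (β lam : ℝ) (f : Cfg n ℓ → ℝ) : ℝ :=
  ∑ ψ : Cfg n ℓ, cPi n ℓ β lam ψ * (f ψ - cMean n ℓ β lam f) ^ 2

/-- The Dirichlet form of the Glauber dynamics. -/
def cDirichlet (n ℓ : ℕ) (β lam : ℝ) (f : Cfg n ℓ → ℝ) : ℝ :=
  (1 / 2) * ∑ ψ : Cfg n ℓ, ∑ ψ' : Cfg n ℓ,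
    cPi n ℓ β lam ψ * glRate n ℓ β lam ψ ψ' * (f ψ' - f ψ) ^ 2

/-- The spectral gap `gap_{n,λ}` of the generator of the Glauber dynamics (ceiling `ℓ`):
by reversibility, the smallest nonzero eigenvalue of minus the generator equals the
infimum of the Rayleigh quotients `E(f,f)/Var(f)`. -/
def specGap (n ℓ : ℕ) (β lam : ℝ) : ℝ :=
  sInf {r : ℝ | ∃ f : Cfg n ℓ → ℝ,
    cVar n ℓ β lam f ≠ 0 ∧ r = cDirichlet n ℓ β lam f / cVar n ℓ β lam f}

end


noncomputable section TopologyPart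
open scoped Classical

/-- Lattice edges: `(v, true)` is the horizontal edge `v, v + e₁`, `(v, false)` the vertical
edge `v, v + e₂`. -/
abbrev LEdge := Site × Bool

/-- The second endpoint of an edge. -/
def eHead (e : LEdge) : Site := e.1 + (if e.2 then (1, 0) else (0, 1))

/-- Edges incident to `V`. -/
def incE (V : Finset Site) : Finset LEdge :=
  (V ×ˢ Finset.univ) ∪ ((V.image fun v => (v - (1, 0), true)) ∪
    (V.image fun v => (v - (0, 1), false)))

lemma mem_incE {V : Finset Site} {e : LEdge} : e ∈ incE V ↔ e.1 ∈ V ∨ eHead e ∈ V := by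
  obtain ⟨v, b⟩ := e
  cases b
  · simp only [incE, eHead, Finset.mem_union, Finset.mem_product, Finset.mem_univ, and_true,
      Finset.mem_image, Prod.mk.injEq]
    simp
    constructor
    · rintro (h | ⟨a, b, h, rfl⟩)
      · exact Or.inl h
      · right; simpa using h
    · rintro (h | h)
      · exact Or.inl h
      · right
        exact ⟨_, _, h, by ext <;> simp⟩
  · simp only [incE, eHead, Finset.mem_union, Finset.mem_product, Finset.mem_univ, and_true,
      Finset.mem_image, Prod.mk.injEq]
    simp
    constructor
    · rintro (h | ⟨a, b, h, rfl⟩)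
      · exact Or.inl h
      · right; simpa using h
    · rintro (h | h)
      · exact Or.inl h
      · right
        exact ⟨_, _, h, by ext <;> simp⟩

/-- The edge boundary of a set. -/
def bdE (A : Finset Site) : Finset LEdge :=
  (incE A).filter fun e => ¬ (e.1 ∈ A ↔ eHead e ∈ A)

lemma mem_bdE {A : Finset Site} {e : LEdge} : e ∈ bdE A ↔ ¬ (e.1 ∈ A ↔ eHead e ∈ A) := by
  simp only [bdE, Finset.mem_filter, mem_incE]
  tauto

/-- The four edges of the plaquette with lower left corner `p`. -/
def plaq (p : Site) : Finset LEdge :=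
  {(p, true), (p, false), (p + (1, 0), false), (p + (0, 1), true)}

/-- The four corners of the plaquette with lower left corner `p`. -/
def cornersP (p : Site) : Finset Site := {p, p + (1, 0), p + (0, 1), p + (1, 1)}

lemma plaq_corners {p : Site} {e : LEdge} (h : e ∈ plaq p) :
    e.1 ∈ cornersP p ∧ eHead e ∈ cornersP p := by
  simp only [plaq, Finset.mem_insert, Finset.mem_singleton] at h
  rcases h with rfl | rfl | rfl | rfl <;> simp [cornersP, eHead, add_assoc]

lemma plaq_const {p : Site} {P : Site → Prop} (h : ∀ e ∈ plaq p, (P e.1 ↔ P (eHead e)))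
    {u v : Site} (hu : u ∈ cornersP p) (hv : v ∈ cornersP p) : P u ↔ P v := by
  have h1 := h (p, true) (by simp [plaq])
  have h2 := h (p, false) (by simp [plaq])
  have h3 := h (p + (1, 0), false) (by simp [plaq])
  have h4 := h (p + (0, 1), true) (by simp [plaq])
  simp [eHead, add_assoc] at h1 h2 h3 h4
  simp only [cornersP, Finset.mem_insert, Finset.mem_singleton] at hu hv
  rcases hu with rfl | rfl | rfl | rfl <;> rcases hv with rfl | rfl | rfl | rfl <;> tauto

/-- Two edges share a plaquette. -/
def padj (e e' : LEdge) : Prop := ∃ p, e ∈ plaq p ∧ e' ∈ plaq p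

lemma padj.symm {e e' : LEdge} (h : padj e e') : padj e' e := by
  obtain ⟨p, a, b⟩ := h; exact ⟨p, b, a⟩

/-- Plaquette adjacency inside a set of edges. -/
def relE (S : Finset LEdge) (a b : LEdge) : Prop := padj a b ∧ a ∈ S ∧ b ∈ S

/-- Connected set of edges. -/
def PConn (S : Finset LEdge) : Prop := ∀ e ∈ S, ∀ e' ∈ S, Relation.ReflTransGen (relE S) e e'

lemma PConn.const {S : Finset LEdge} (hS : PConn S) {Q : LEdge → Prop}
    (h : ∀ a ∈ S, ∀ b ∈ S, padj a b → Q a → Q b) {a b : LEdge} (ha : a ∈ S) (hb : b ∈ S)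
    (hq : Q a) : Q b := by
  have := hS a ha b hb
  clear hb
  induction this with
  | refl => exact hq
  | tail _ h2 ih => exact h _ h2.2.1 _ h2.2.2 h2.1 ih

/-- The class of contours: nonempty finite sets with a connected edge boundary. -/
def ContC (A : Finset Site) : Prop := A.Nonempty ∧ PConn (bdE A)

lemma exit_dir (A : Finset Site) (d : Site) (hd : d ≠ 0) {x : Site} (hx : x ∈ A) :
    ∃ k : ℕ, (∀ j : ℕ, j ≤ k → x + j • d ∈ A) ∧ x + (k + 1) • d ∉ A := by
  have : ∃ n : ℕ, x + n • d ∉ A := by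
    by_contra hcon
    push Not at hcon
    have hinj : Function.Injective (fun n : ℕ => x + n • d) := by
      intro a b hab
      simp only [add_right_inj] at hab
      have h0 : ((a : ℤ) - b) • d = 0 := by
        rw [sub_smul]; simpa [sub_eq_zero] using hab
      rcases smul_eq_zero.1 h0 with h | h
      · omega
      · exact absurd h hd
    exact Set.infinite_range_of_injective hinj
      ((A.finite_toSet).subset (by rintro _ ⟨n, rfl⟩; exact hcon n))
  classical
  have hf := Nat.find_spec this
  have hm : ∀ j < Nat.find this, x + j • d ∈ A := fun j hj => by
    simpa using Nat.find_min this hj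
  have hpos : Nat.find this ≠ 0 := by
    intro h0
    rw [h0] at hf; simp [hx] at hf
  obtain ⟨k, hk⟩ := Nat.exists_eq_succ_of_ne_zero hpos
  refine ⟨k, fun j hj => hm j (by omega), ?_⟩
  rw [hk] at hf
  simpa using hf

lemma right_exit (A : Finset Site) {x : Site} (hx : x ∈ A) :
    ∃ k : ℕ, (∀ j : ℕ, j ≤ k → (x.1 + j, x.2) ∈ A) ∧ (x.1 + k + 1, x.2) ∉ A := by
  obtain ⟨k, h1, h2⟩ := exit_dir A (1, 0) (by simp) hx
  refine ⟨k, fun j hj => ?_, ?_⟩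
  · have := h1 j hj
    convert this using 1; ext <;> simp
  · convert h2 using 2; ext <;> simp [add_assoc]

lemma bdE_empty {A : Finset Site} (h : bdE A = ∅) : A = ∅ := by
  by_contra hA
  obtain ⟨x, hx⟩ := Finset.nonempty_iff_ne_empty.2 hA
  obtain ⟨k, h1, h2⟩ := right_exit A hx
  have : ((x.1 + k, x.2), true) ∈ bdE A := by
    rw [mem_bdE]
    simp only [eHead, if_true]
    have := h1 k le_rfl
    simp [this, h2]
  simp [h] at this

lemma bdE_inj {A B : Finset Site} (h : bdE A = bdE B) : A = B := by
  have : symmDiff A B = ∅ := by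
    apply bdE_empty
    ext e
    have := congrArg (fun S => e ∈ S) h
    simp only [mem_bdE, eq_iff_iff] at this
    simp only [mem_bdE, Finset.mem_symmDiff, Finset.notMem_empty, iff_false]
    tauto
  exact symmDiff_eq_bot.1 this

/-- Component of an edge. -/
def compE (S : Finset LEdge) (e : LEdge) : Finset LEdge :=
  S.filter fun e' => Relation.ReflTransGen (relE S) e e'

lemma compE_closed {S : Finset LEdge} {e a b : LEdge} (ha : a ∈ compE S e) (hb : b ∈ S)
    (h : padj a b) : b ∈ compE S e := by
  simp only [compE, Finset.mem_filter] at ha ⊢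
  exact ⟨hb, ha.2.tail ⟨h, ha.1, hb⟩⟩

lemma compE_subset {S : Finset LEdge} {e : LEdge} : compE S e ⊆ S := Finset.filter_subset _ _

lemma self_mem_compE {S : Finset LEdge} {e : LEdge} (h : e ∈ S) : e ∈ compE S e := by
  simp only [compE, Finset.mem_filter]
  exact ⟨h, .refl⟩

lemma relE_symm (S : Finset LEdge) : Std.Symm (relE S) := ⟨fun _ _ h => ⟨h.1.symm, h.2.2, h.2.1⟩⟩

lemma compE_eq {S : Finset LEdge} {e a : LEdge} (ha : a ∈ compE S e) :
    compE S a = compE S e := by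
  simp only [compE, Finset.mem_filter] at ha
  haveI := relE_symm S
  have h2 : Relation.ReflTransGen (relE S) a e := (Relation.ReflTransGen.stdSymm (r := relE S)).symm _ _ ha.2
  ext b
  simp only [compE, Finset.mem_filter]
  exact ⟨fun h => ⟨h.1, ha.2.trans h.2⟩, fun h => ⟨h.1, h2.trans h.2⟩⟩

lemma compE_pconn {S : Finset LEdge} {e : LEdge} : PConn (compE S e) := by
  have key : ∀ a ∈ compE S e, Relation.ReflTransGen (relE (compE S e)) e a := by
    intro a ha
    have h := (Finset.mem_filter.1 ha).2
    clear ha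
    induction h with
    | refl => exact .refl
    | @tail b c h1 h2 ih =>
      refine ih.tail ⟨h2.1, ?_, ?_⟩
      · exact Finset.mem_filter.2 ⟨h2.2.1, h1⟩
      · exact Finset.mem_filter.2 ⟨h2.2.2, h1.tail h2⟩
  intro a ha b hb
  haveI := relE_symm (compE S e)
  exact ((Relation.ReflTransGen.stdSymm (r := relE (compE S e))).symm _ _ (key a ha)).trans (key b hb)

end TopologyPart

noncomputable section TopologyPart2
open scoped Classical

/-- Star-closeness. -/
def starNear (u v : Site) : Prop := |u.1 - v.1| ≤ 1 ∧ |u.2 - v.2| ≤ 1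

/-- Domains whose complement is star-connected (formulated by invariant finite sets). -/
def Good (V : Finset Site) : Prop :=
  ∀ F : Finset Site, (∀ u u', u ∉ V → u' ∉ V → starNear u u' → (u ∈ F ↔ u' ∈ F)) → F ⊆ V

lemma corners_near {p u v : Site} (hu : u ∈ cornersP p) (hv : v ∈ cornersP p) :
    starNear u v := by
  simp only [cornersP, Finset.mem_insert, Finset.mem_singleton] at hu hv
  rcases hu with rfl | rfl | rfl | rfl <;> rcases hv with rfl | rfl | rfl | rfl <;>
    simp [starNear]

lemma good_of_contC {B : Finset Site} (hB : ContC B) : Good B := by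
  intro F hF
  by_contra hsub
  have key : ∀ u : Site, u ∈ F → u ∉ B → ∃ k : ℕ, (u.1 + k, u.2) ∈ F ∧ (u.1 + k, u.2) ∉ B ∧
      (u.1 + k + 1, u.2) ∈ B := by
    intro u hu huB
    obtain ⟨k, h1, h2⟩ := right_exit (F \ B) (x := u) (by simp [hu, huB])
    have h3 := Finset.mem_sdiff.1 (h1 k le_rfl)
    refine ⟨k, h3.1, h3.2, ?_⟩
    by_contra h4
    apply h2
    rw [Finset.mem_sdiff]
    refine ⟨(hF _ _ h3.2 h4 ?_).1 h3.1, h4⟩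
    simp [starNear]
  obtain ⟨u, hu, huB⟩ := Finset.not_subset.1 hsub
  obtain ⟨k, hk1, hk2, hk3⟩ := key u hu huB
  let Q : LEdge → Prop := fun e => (e.1 ∉ B ∧ e.1 ∈ F) ∨ (eHead e ∉ B ∧ eHead e ∈ F)
  obtain ⟨x, hx, hmax⟩ := Finset.exists_max_image B (fun x => x.1) hB.1
  have hx1 : (x.1 + 1, x.2) ∉ B := by
    intro h
    have := hmax _ h
    simp at this
  have hQ : Q (x, true) := by
    refine hB.2.const (Q := Q) ?_ (a := ((u.1 + k, u.2), true)) ?_ ?_ ?_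
    · rintro a ha b hb ⟨p, hap, hbp⟩ hq
      rw [mem_bdE] at ha hb
      have ca := plaq_corners hap
      have cb := plaq_corners hbp
      have : (b.1 ∉ B ∧ eHead b ∈ B) ∨ (b.1 ∈ B ∧ eHead b ∉ B) := by tauto
      rcases hq with ⟨q1, q2⟩ | ⟨q1, q2⟩ <;> rcases this with ⟨b1, b2⟩ | ⟨b1, b2⟩
      · exact Or.inl ⟨b1, (hF _ _ q1 b1 (corners_near ca.1 cb.1)).1 q2⟩
      · exact Or.inr ⟨b2, (hF _ _ q1 b2 (corners_near ca.1 cb.2)).1 q2⟩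
      · exact Or.inl ⟨b1, (hF _ _ q1 b1 (corners_near ca.2 cb.1)).1 q2⟩
      · exact Or.inr ⟨b2, (hF _ _ q1 b2 (corners_near ca.2 cb.2)).1 q2⟩
    · rw [mem_bdE]; simp [eHead, hk2, hk3]
    · rw [mem_bdE]
      have : x + (1, 0) = (x.1 + 1, x.2) := by ext <;> simp
      simp [eHead, hx, this, hx1]
    · exact Or.inl ⟨hk2, hk1⟩
  have hx2 : (x.1 + 1, x.2) ∈ F := by
    have : x + (1, 0) = (x.1 + 1, x.2) := by ext <;> simp
    rcases hQ with h | h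
    · exact absurd hx h.1
    · simpa [eHead, this] using h.2
  obtain ⟨k', _, _, h3⟩ := key _ hx2 hx1
  have := hmax _ h3
  simp at this
  omega

lemma good_of_conn {V : Finset Site} (hV : connectedIn ((↑V : Set Site)ᶜ)) : Good V := by
  intro F hF
  intro u hu
  by_contra huV
  obtain ⟨w, hw⟩ := Infinite.exists_notMem_finset (V ∪ F)
  rw [Finset.mem_union, not_or] at hw
  have h := hV u (by simpa using huV) w (by simpa using hw.1)
  have : ∀ y, Relation.ReflTransGen
      (fun a b => adjS a b ∧ a ∈ ((↑V : Set Site)ᶜ) ∧ b ∈ ((↑V : Set Site)ᶜ)) u y → y ∈ F := by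
    intro y hy
    induction hy with
    | refl => exact hu
    | @tail b c _ h2 ih =>
      refine (hF b c (by simpa using h2.2.1) (by simpa using h2.2.2) ?_).1 ih
      have h3 := h2.1
      simp only [adjS, dirs, Finset.mem_insert, Finset.mem_singleton] at h3
      have e1 : ∀ a b : Site, (a - b).1 = a.1 - b.1 := fun a b => rfl
      have e2 : ∀ a b : Site, (a - b).2 = a.2 - b.2 := fun a b => rfl
      rcases h3 with h3 | h3 | h3 | h3 <;>
        · have h4 := congrArg Prod.fst h3
          have h5 := congrArg Prod.snd h3
          rw [e1] at h4; rw [e2] at h5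
          simp only at h4 h5
          constructor <;> rw [abs_le] <;> omega
  exact hw.2 (this w h)

lemma zmod2_iff (a b c : ZMod 2) (h : a + b = c) : (¬ (a = 1 ↔ b = 1)) ↔ c = 1 := by
  subst h; revert a b; decide

/-- Indicator mod 2. -/
def chi (S : Finset LEdge) (e : LEdge) : ZMod 2 := if e ∈ S then 1 else 0

lemma zmod2_self (a : ZMod 2) : a + a = 0 := by revert a; decide

/-- Every plaquette-even finite set of edges is a boundary. -/
lemma exists_hull (S : Finset LEdge)
    (hS : ∀ p, chi S (p, true) + chi S (p, false) + chi S (p + (1, 0), false) +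
      chi S (p + (0, 1), true) = 0) : ∃ A : Finset Site, bdE A = S := by
  let T : ℤ → ℤ → Finset LEdge := fun x y => S.filter fun e => e.2 = true ∧ e.1.2 = y ∧ x ≤ e.1.1
  let f : ℤ → ℤ → ZMod 2 := fun x y => ((T x y).card : ZMod 2)
  have hstep : ∀ x y, f x y = f (x + 1) y + chi S ((x, y), true) := by
    intro x y
    by_cases hm : ((x, y), true) ∈ S
    · have : T x y = insert ((x, y), true) (T (x + 1) y) := by
        ext ⟨⟨a, b⟩, c⟩
        simp only [T, Finset.mem_filter, Finset.mem_insert, Prod.mk.injEq]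
        constructor
        · rintro ⟨h1, rfl, rfl, h4⟩
          rcases h4.eq_or_lt with h | h
          · left; simp [h]
          · right; exact ⟨h1, rfl, rfl, h⟩
        · rintro (⟨⟨rfl, rfl⟩, rfl⟩ | ⟨h1, rfl, rfl, h4⟩)
          · exact ⟨hm, rfl, rfl, le_rfl⟩
          · exact ⟨h1, rfl, rfl, by omega⟩
      simp only [f]
      rw [this, Finset.card_insert_of_notMem]
      · simp [chi, hm]
      · simp [T]
    · have : T x y = T (x + 1) y := by
        ext ⟨⟨a, b⟩, c⟩
        simp only [T, Finset.mem_filter]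
        constructor
        · rintro ⟨h1, rfl, rfl, h4⟩
          rcases h4.eq_or_lt with h | h
          · exact absurd (by rw [h]; exact h1) hm
          · exact ⟨h1, rfl, rfl, h⟩
        · rintro ⟨h1, rfl, rfl, h4⟩
          exact ⟨h1, rfl, rfl, by simp at h4 ⊢; omega⟩
      simp only [f]
      rw [this]; simp [chi, hm]
  obtain ⟨N, hN⟩ : ∃ N : ℕ, ∀ e ∈ S, e.1.1 < N ∧ -(N : ℤ) < e.1.1 ∧ e.1.2 < N ∧ -(N : ℤ) < e.1.2 := by
    refine ⟨(∑ e ∈ S, (e.1.1.natAbs + e.1.2.natAbs)) + 1, fun e he => ?_⟩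
    have := Finset.single_le_sum (f := fun e : LEdge => (e.1.1.natAbs + e.1.2.natAbs))
      (fun _ _ => Nat.zero_le _) he
    omega
  have hzero : ∀ x y : ℤ, ((N : ℤ) ≤ x ∨ N ≤ y ∨ y ≤ -(N : ℤ)) → f x y = 0 := by
    intro x y h
    have : T x y = ∅ := by
      rw [Finset.eq_empty_iff_forall_notMem]
      intro e he
      simp only [T, Finset.mem_filter] at he
      have := hN e he.1
      omega
    simp [f, this]
  have hchi : ∀ x y b, ((N : ℤ) ≤ x ∨ x ≤ -(N : ℤ)) → chi S ((x, y), b) = 0 := by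
    intro x y b h
    have : ((x, y), b) ∉ S := by
      intro he
      have := hN _ he
      simp only at this
      omega
    simp [chi, this]
  have hvert : ∀ x y, f x y + f x (y + 1) = chi S ((x, y), false) := by
    have h1 : ∀ n : ℕ, ∀ x y, (N : ℤ) - n ≤ x → f x y + f x (y + 1) = chi S ((x, y), false) := by
      intro n
      induction n with
      | zero =>
        intro x y h
        simp at h
        rw [hzero _ _ (Or.inl h), hzero _ _ (Or.inl h), hchi _ _ _ (Or.inl h)]; simp
      | succ n ih =>
        intro x y h
        have a := ih (x + 1) y (by push_cast at h; omega)
        rw [hstep x y, hstep x (y + 1)]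
        have b := hS (x, y)
        simp only [Prod.mk_add_mk, add_zero] at b
        have c := zmod2_self (chi S ((x, y), false))
        linear_combination a + b - c
    intro x y
    exact h1 (N - x).natAbs x y (by omega)
  have hleft : ∀ x y, x ≤ -(N : ℤ) → f x y = 0 := by
    have h1 : ∀ n : ℕ, ∀ x y, (N : ℤ) - n ≤ y → x ≤ -(N : ℤ) → f x y = 0 := by
      intro n
      induction n with
      | zero => intro x y h hx; exact hzero _ _ (by simp at h; omega)
      | succ n ih =>
        intro x y h hx
        have a := ih x (y + 1) (by push_cast at h; omega) hx
        have b := hvert x y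
        rw [a, hchi _ _ _ (Or.inr hx)] at b
        simpa using b
    intro x y
    exact h1 (N - y).natAbs x y (by omega)
  let A : Finset Site := (Finset.Icc (-(N : ℤ)) N ×ˢ Finset.Icc (-(N : ℤ)) N).filter
    fun p => f p.1 p.2 = 1
  have hA : ∀ p, p ∈ A ↔ f p.1 p.2 = 1 := by
    intro p
    simp only [A, Finset.mem_filter, Finset.mem_product, Finset.mem_Icc, and_iff_right_iff_imp]
    intro h
    by_contra hcon
    have : f p.1 p.2 = 0 := by
      by_cases hx : p.1 ≤ -(N : ℤ)
      · exact hleft _ _ hx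
      · exact hzero _ _ (by omega)
    rw [this] at h
    exact absurd h (by decide)
  refine ⟨A, ?_⟩
  ext ⟨⟨x, y⟩, b⟩
  rw [mem_bdE, hA, hA]
  have hc : ∀ e, chi S e = 1 ↔ e ∈ S := by
    intro e; unfold chi; split_ifs with h <;> simp [h]
  rw [← hc]
  apply zmod2_iff
  cases b
  · simpa [eHead] using hvert x y
  · have := hstep x y
    simp only [eHead, if_true, Prod.mk_add_mk, add_zero]
    rw [this]
    linear_combination zmod2_self (f (x + 1) y)

end TopologyPart2

noncomputable section TopologyPart3
open scoped Classical

/-- `A` is the filled-in version of one boundary component of `L`. -/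
def IsHull (L A : Finset Site) : Prop := ∃ e0 ∈ bdE L, bdE A = compE (bdE L) e0

lemma chi_bdE (L : Finset Site) (e : LEdge) :
    chi (bdE L) e = (if e.1 ∈ L then 1 else 0) + (if eHead e ∈ L then 1 else 0) := by
  unfold chi
  simp only [mem_bdE]
  by_cases h1 : e.1 ∈ L <;> by_cases h2 : eHead e ∈ L <;> simp [h1, h2]
  decide

lemma exists_isHull {L : Finset Site} {e0 : LEdge} :
    ∃ A, bdE A = compE (bdE L) e0 := by
  apply exists_hull
  intro p
  by_cases hm : ∃ e ∈ plaq p, e ∈ compE (bdE L) e0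
  · obtain ⟨e, hep, hec⟩ := hm
    have h : ∀ e' ∈ plaq p, chi (compE (bdE L) e0) e' = chi (bdE L) e' := by
      intro e' he'
      unfold chi
      congr 1
      rw [eq_iff_iff]
      exact ⟨fun h => compE_subset h, fun h => compE_closed hec h ⟨p, hep, he'⟩⟩
    rw [h _ (by simp [plaq]), h _ (by simp [plaq]), h _ (by simp [plaq]), h _ (by simp [plaq])]
    simp only [chi_bdE]
    simp only [eHead, if_true, add_assoc, Prod.mk_add_mk]
    have : ∀ a b c d : ZMod 2, a + (b + (a + (c + (b + (d + (c + d)))))) = 0 := by decide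
    convert this (if p ∈ L then 1 else 0) (if p + (1, 0) ∈ L then 1 else 0)
      (if p + (0, 1) ∈ L then 1 else 0) (if p + (1, 1) ∈ L then 1 else 0) using 1
    simp
  · push Not at hm
    have h : ∀ e' ∈ plaq p, chi (compE (bdE L) e0) e' = 0 := fun e' he' => by
      simp [chi, hm e' he']
    rw [h _ (by simp [plaq]), h _ (by simp [plaq]), h _ (by simp [plaq]), h _ (by simp [plaq])]
    simp

lemma IsHull.closed {L A : Finset Site} (hA : IsHull L A) {a b : LEdge} (ha : a ∈ bdE A)
    (hb : b ∈ bdE L) (h : padj a b) : b ∈ bdE A := by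
  obtain ⟨e0, _, he⟩ := hA
  rw [he] at ha ⊢
  exact compE_closed ha hb h

lemma IsHull.sub {L A : Finset Site} (hA : IsHull L A) : bdE A ⊆ bdE L := by
  obtain ⟨e0, _, he⟩ := hA
  rw [he]; exact compE_subset

lemma IsHull.contC {L A : Finset Site} (hA : IsHull L A) : ContC A := by
  obtain ⟨e0, h0, he⟩ := hA
  refine ⟨?_, by rw [he]; exact compE_pconn⟩
  by_contra h
  rw [Finset.not_nonempty_iff_eq_empty] at h
  have := self_mem_compE h0
  rw [← he, h, mem_bdE] at this
  simp at this

lemma IsHull.eq {L A B : Finset Site} (hA : IsHull L A) (hB : IsHull L B) {e : LEdge}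
    (ha : e ∈ bdE A) (hb : e ∈ bdE B) : A = B := by
  obtain ⟨e0, _, he⟩ := hA
  obtain ⟨e1, _, he'⟩ := hB
  apply bdE_inj
  rw [he] at ha
  rw [he'] at hb
  rw [he, he', ← compE_eq ha, ← compE_eq hb]

lemma const_on {B : Finset Site} (hB : PConn (bdE B)) {P : Site → Prop}
    (hP : ∀ p, (∃ e ∈ plaq p, e ∈ bdE B) → ∀ e ∈ plaq p, (P e.1 ↔ P (eHead e)))
    {e e' : LEdge} (he : e ∈ bdE B) (he' : e' ∈ bdE B) :
    (P e.1 ↔ P e'.1) ∧ (P e.1 ↔ P (eHead e')) := by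
  have hex : ∀ a : LEdge, ∃ p, a ∈ plaq p := by
    rintro ⟨v, b⟩
    refine ⟨v, ?_⟩
    cases b <;> simp [plaq]
  have h1 : P e.1 ↔ P e'.1 := by
    refine hB.const (Q := fun a => (P e.1 ↔ P a.1)) ?_ he he' Iff.rfl
    rintro a ha b hb ⟨p, hap, hbp⟩ hq
    exact hq.trans (plaq_const (hP p ⟨a, hap, ha⟩) (plaq_corners hap).1 (plaq_corners hbp).1)
  refine ⟨h1, h1.trans ?_⟩
  obtain ⟨p, hp⟩ := hex e'
  exact hP p ⟨e', hp, he'⟩ e' hp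

lemma IsHull.const_other {L A B : Finset Site} (hA : IsHull L A) (hB : IsHull L B) (hne : A ≠ B)
    {e e' : LEdge} (he : e ∈ bdE B) (he' : e' ∈ bdE B) :
    (e.1 ∈ A ↔ e'.1 ∈ A) ∧ (e.1 ∈ A ↔ eHead e' ∈ A) := by
  refine const_on (P := fun v => v ∈ A) hB.contC.2 ?_ he he'
  rintro p ⟨b, hbp, hb⟩ a hap
  by_contra hcon
  have haA : a ∈ bdE A := mem_bdE.2 hcon
  exact hne (hA.eq hB (hA.closed haA (hB.sub hb) ⟨p, hap, hbp⟩) hb)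

lemma contC_bdE_nonempty {A : Finset Site} (h : A.Nonempty) : (bdE A).Nonempty := by
  rw [Finset.nonempty_iff_ne_empty]
  intro h'
  rw [bdE_empty h'] at h
  simp at h

lemma IsHull.trichotomy {L A B : Finset Site} (hA : IsHull L A) (hB : IsHull L B) :
    Disjoint A B ∨ A ⊆ B ∨ B ⊆ A := by
  by_cases hne : A = B
  · right; left; rw [hne]
  obtain ⟨a0, ha0⟩ := contC_bdE_nonempty hA.contC.1
  obtain ⟨b0, hb0⟩ := contC_bdE_nonempty hB.contC.1
  have hca : ∀ e ∈ bdE A, (a0.1 ∈ B ↔ e.1 ∈ B) ∧ (a0.1 ∈ B ↔ eHead e ∈ B) :=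
    fun e he => hB.const_other hA (Ne.symm hne) ha0 he
  have hcb : ∀ e ∈ bdE B, (b0.1 ∈ A ↔ e.1 ∈ A) ∧ (b0.1 ∈ A ↔ eHead e ∈ A) :=
    fun e he => hA.const_other hB hne hb0 he
  simp only [mem_bdE] at hca hcb
  by_cases c : b0.1 ∈ A <;> by_cases c' : a0.1 ∈ B <;>
    simp only [c, c', true_iff, false_iff] at hca hcb
  · right; left
    have : A ∪ B = ∅ := by
      apply bdE_empty
      rw [Finset.eq_empty_iff_forall_notMem]
      intro e
      rw [mem_bdE, not_not, Finset.mem_union, Finset.mem_union]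
      have := hca e; have := hcb e
      tauto
    rw [Finset.union_eq_empty] at this
    simp [this.1]
  · right; right
    have : B \ A = ∅ := by
      apply bdE_empty
      rw [Finset.eq_empty_iff_forall_notMem]
      intro e
      rw [mem_bdE, not_not, Finset.mem_sdiff, Finset.mem_sdiff]
      have := hca e; have := hcb e
      tauto
    exact Finset.sdiff_eq_empty_iff_subset.1 this
  · right; left
    have : A \ B = ∅ := by
      apply bdE_empty
      rw [Finset.eq_empty_iff_forall_notMem]
      intro e
      rw [mem_bdE, not_not, Finset.mem_sdiff, Finset.mem_sdiff]
      have := hca e; have := hcb e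
      tauto
    exact Finset.sdiff_eq_empty_iff_subset.1 this
  · left
    have : A ∩ B = ∅ := by
      apply bdE_empty
      rw [Finset.eq_empty_iff_forall_notMem]
      intro e
      rw [mem_bdE, not_not, Finset.mem_inter, Finset.mem_inter]
      have := hca e; have := hcb e
      tauto
    exact Finset.disjoint_iff_inter_eq_empty.2 this

/-- The finite set of hulls. -/
def hulls (L : Finset Site) : Finset (Finset Site) :=
  (bdE L).image fun e => (exists_isHull (L := L) (e0 := e)).choose

lemma mem_hulls {L A : Finset Site} : A ∈ hulls L ↔ IsHull L A := by
  simp only [hulls, Finset.mem_image]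
  constructor
  · rintro ⟨e, he, rfl⟩
    exact ⟨e, he, (exists_isHull (L := L) (e0 := e)).choose_spec⟩
  · rintro ⟨e, he, h⟩
    refine ⟨e, he, bdE_inj ?_⟩
    rw [h]
    exact (exists_isHull (L := L) (e0 := e)).choose_spec

lemma hull_cover {L : Finset Site} {v : Site} (hv : v ∈ L) : ∃ A, IsHull L A ∧ v ∈ A := by
  let ind : Finset Site → Site → ZMod 2 := fun A v => if v ∈ A then 1 else 0
  let g : Site → ZMod 2 := fun v => ind L v + ∑ A ∈ hulls L, ind A v
  let D : Finset Site := (L ∪ (hulls L).biUnion id).filter fun v => g v = 1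
  have hD : ∀ v, v ∈ D ↔ g v = 1 := by
    intro v
    simp only [D, Finset.mem_filter, and_iff_right_iff_imp]
    intro h
    by_contra hcon
    simp only [Finset.mem_union, Finset.mem_biUnion, id, not_or, not_exists, not_and] at hcon
    have : g v = 0 := by
      simp only [g, ind, hcon.1, if_false, zero_add]
      apply Finset.sum_eq_zero
      intro A hA
      simp [hcon.2 A hA]
    rw [this] at h
    exact absurd h (by decide)
  have hedge : ∀ e : LEdge, g e.1 + g (eHead e) = 0 := by
    intro e
    have h1 : g e.1 + g (eHead e) = chi (bdE L) e + ∑ A ∈ hulls L, chi (bdE A) e := by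
      simp only [g, chi_bdE, ind, Finset.sum_add_distrib]
      ring
    rw [h1]
    by_cases he : e ∈ bdE L
    · obtain ⟨A, hA⟩ := exists_isHull (L := L) (e0 := e)
      have hAh : IsHull L A := ⟨e, he, hA⟩
      have heA : e ∈ bdE A := by rw [hA]; exact self_mem_compE he
      rw [Finset.sum_eq_single_of_mem A (mem_hulls.2 hAh)]
      · simp only [chi, he, heA, if_true]; decide
      · intro B hB hBA
        have : e ∉ bdE B := fun h => hBA ((mem_hulls.1 hB).eq hAh h heA)
        simp [chi, this]
    · rw [Finset.sum_eq_zero]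
      · simp [chi, he]
      · intro B hB
        have : e ∉ bdE B := fun h => he ((mem_hulls.1 hB).sub h)
        simp [chi, this]
  have hDe : D = ∅ := by
    apply bdE_empty
    rw [Finset.eq_empty_iff_forall_notMem]
    intro e
    rw [mem_bdE, hD, hD, zmod2_iff _ _ _ (hedge e)]
    decide
  have hg : g v ≠ 1 := by
    rw [Ne, ← hD, hDe]; simp
  by_contra hcon
  push Not at hcon
  apply hg
  simp only [g, ind, hv, if_true]
  rw [Finset.sum_eq_zero]
  · simp
  · intro A hA
    simp [hcon A (mem_hulls.1 hA)]

/-- Outer contours of `L`: the maximal hulls. -/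
def outer (L : Finset Site) : Finset (Finset Site) :=
  (hulls L).filter fun A => Maximal (fun B => B ∈ hulls L) A

lemma mem_outer {L A : Finset Site} : A ∈ outer L ↔ Maximal (fun B => B ∈ hulls L) A := by
  simp only [outer, Finset.mem_filter, and_iff_right_iff_imp]
  exact fun h => h.prop

lemma outer_isHull {L A : Finset Site} (h : A ∈ outer L) : IsHull L A :=
  mem_hulls.1 (mem_outer.1 h).prop

lemma outer_contC {L A : Finset Site} (h : A ∈ outer L) : ContC A := (outer_isHull h).contC

lemma outer_disj {L A B : Finset Site} (hA : A ∈ outer L) (hB : B ∈ outer L) (hne : A ≠ B) :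
    Disjoint A B := by
  rcases (outer_isHull hA).trichotomy (outer_isHull hB) with h | h | h
  · exact h
  · exact absurd ((mem_outer.1 hA).eq_of_le (mem_outer.1 hB).prop h) hne
  · exact absurd ((mem_outer.1 hB).eq_of_le (mem_outer.1 hA).prop h).symm hne

lemma outer_cover {L : Finset Site} {v : Site} (hv : v ∈ L) : ∃ A ∈ outer L, v ∈ A := by
  obtain ⟨A, hA, hvA⟩ := hull_cover hv
  obtain ⟨m, h1, h2⟩ := (hulls L).exists_le_maximal (mem_hulls.2 hA)
  exact ⟨m, mem_outer.2 h2, h1 hvA⟩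

lemma hull_plaq {L A : Finset Site} (hA : IsHull L A) {p : Site}
    (hp : ∃ e ∈ plaq p, e ∈ bdE A) :
    ∀ e ∈ plaq p, ((e.1 ∈ A ↔ e.1 ∈ L) ↔ (eHead e ∈ A ↔ eHead e ∈ L)) := by
  obtain ⟨a, hap, ha⟩ := hp
  intro e he
  have h : e ∈ bdE A ↔ e ∈ bdE L :=
    ⟨fun h => hA.sub h, fun h => hA.closed ha h ⟨p, hap, he⟩⟩
  rw [mem_bdE, mem_bdE] at h
  tauto

lemma outer_orient {L A : Finset Site} (hA : A ∈ outer L) {e : LEdge} (he : e ∈ bdE A) :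
    (e.1 ∈ A ↔ e.1 ∈ L) ∧ (eHead e ∈ A ↔ eHead e ∈ L) := by
  have hh := outer_isHull hA
  have hc := const_on (P := fun v => (v ∈ A ↔ v ∈ L)) hh.contC.2
    (fun p hp => hull_plaq hh hp) he he
  suffices h : (e.1 ∈ A ↔ e.1 ∈ L) by exact ⟨h, hc.2.1 h⟩
  by_contra hcon
  have hcon2 : ¬ (eHead e ∈ A ↔ eHead e ∈ L) := fun h => hcon (hc.2.2 h)
  have he2 := mem_bdE.1 he
  -- an outer endpoint lying in `L`
  obtain ⟨o, i, ho, hi, hoA, hiA, hoL⟩ : ∃ o i, (o = e.1 ∨ o = eHead e) ∧ (i = e.1 ∨ i = eHead e) ∧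
      o ∉ A ∧ i ∈ A ∧ o ∈ L := by
    by_cases h1 : e.1 ∈ A
    · exact ⟨eHead e, e.1, Or.inr rfl, Or.inl rfl, by tauto, h1, by tauto⟩
    · exact ⟨e.1, eHead e, Or.inl rfl, Or.inr rfl, h1, by tauto, by tauto⟩
  obtain ⟨A', hA', hoA'⟩ := hull_cover hoL
  have hne : A' ≠ A := fun h => hoA (h ▸ hoA')
  have hcc := hA'.const_other hh hne he he
  have hiA' : i ∈ A' := by
    rcases ho with rfl | rfl <;> rcases hi with rfl | rfl <;> tauto
  rcases hh.trichotomy hA' with h | h | h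
  · exact Finset.disjoint_left.1 h hiA hiA'
  · exact hne ((mem_outer.1 hA).eq_of_le (mem_hulls.2 hA') h).symm
  · exact hoA (h hoA')

lemma near_corners {u u' : Site} (h : starNear u u') :
    ∃ p, u ∈ cornersP p ∧ u' ∈ cornersP p := by
  obtain ⟨a, b⟩ := u
  obtain ⟨c, d⟩ := u'
  obtain ⟨h1, h2⟩ := h
  simp only [abs_le] at h1 h2
  refine ⟨(min a c, min b d), ?_, ?_⟩ <;>
    simp only [cornersP, Finset.mem_insert, Finset.mem_singleton, Prod.mk_add_mk, Prod.mk.injEq] <;>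
    omega

lemma outer_sub {L A V : Finset Site} (hV : Good V) (hL : L ⊆ V) (hA : A ∈ outer L) : A ⊆ V := by
  apply hV
  intro u u' hu hu' hn
  obtain ⟨p, hp, hp'⟩ := near_corners hn
  have hh := outer_isHull hA
  have huL : u ∉ L := fun h => hu (hL h)
  have huL' : u' ∉ L := fun h => hu' (hL h)
  by_cases hm : ∃ e ∈ plaq p, e ∈ bdE A
  · have := plaq_const (P := fun v => (v ∈ A ↔ v ∈ L)) (hull_plaq hh hm) hp hp'
    simp only [huL, huL', iff_false] at this
    exact not_iff_not.1 this
  · refine plaq_const (P := fun v => v ∈ A) ?_ hp hp'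
    intro e he
    by_contra hcon
    exact hm ⟨e, he, mem_bdE.2 hcon⟩

/-- The union of a family. -/
def uni (M : Finset (Finset Site)) : Finset Site := M.biUnion id

lemma mem_uni {M : Finset (Finset Site)} {v : Site} : v ∈ uni M ↔ ∃ A ∈ M, v ∈ A := by
  simp [uni]

lemma mem_bdE_uni {L : Finset Site} {M : Finset (Finset Site)} (hM : M ⊆ outer L) {e : LEdge} :
    e ∈ bdE (uni M) ↔ ∃ A ∈ M, e ∈ bdE A := by
  constructor
  · intro h
    rw [mem_bdE, mem_uni, mem_uni] at h
    by_cases h1 : ∃ A ∈ M, e.1 ∈ A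
    · obtain ⟨A, hA, h2⟩ := h1
      refine ⟨A, hA, mem_bdE.2 ?_⟩
      intro h3
      exact h ⟨fun _ => ⟨A, hA, h3.1 h2⟩, fun _ => ⟨A, hA, h2⟩⟩
    · have h3 : ∃ A ∈ M, eHead e ∈ A := by tauto
      obtain ⟨A, hA, h2⟩ := h3
      refine ⟨A, hA, mem_bdE.2 ?_⟩
      intro h3
      exact h1 ⟨A, hA, h3.2 h2⟩
  · rintro ⟨A, hA, he⟩
    have ho := outer_orient (hM hA) he
    have he2 := mem_bdE.1 he
    rw [mem_bdE, mem_uni, mem_uni]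
    intro hiff
    by_cases h1 : e.1 ∈ A
    · have h2 : eHead e ∉ A := by tauto
      obtain ⟨A', hA', h3⟩ := hiff.1 ⟨A, hA, h1⟩
      have hne : A' ≠ A := fun h => h2 (h ▸ h3)
      have h4 : e.1 ∉ A' := fun h =>
        Finset.disjoint_left.1 (outer_disj (hM hA') (hM hA) hne) h h1
      have ho' := outer_orient (hM hA') (e := e) (mem_bdE.2 (by tauto))
      tauto
    · have h2 : eHead e ∈ A := by tauto
      obtain ⟨A', hA', h3⟩ := hiff.2 ⟨A, hA, h2⟩
      have hne : A' ≠ A := fun h => h1 (h ▸ h3)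
      have h4 : eHead e ∉ A' := fun h =>
        Finset.disjoint_left.1 (outer_disj (hM hA') (hM hA) hne) h h2
      have ho' := outer_orient (hM hA') (e := e) (mem_bdE.2 (by tauto))
      tauto

lemma outer_bdE_disj {L A B : Finset Site} (hA : A ∈ outer L) (hB : B ∈ outer L) (hne : A ≠ B) :
    Disjoint (bdE A) (bdE B) := by
  rw [Finset.disjoint_left]
  intro e h1 h2
  exact hne ((outer_isHull hA).eq (outer_isHull hB) h1 h2)

lemma card_bdE_uni {L : Finset Site} {M : Finset (Finset Site)} (hM : M ⊆ outer L) :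
    (bdE (uni M)).card = ∑ A ∈ M, (bdE A).card := by
  have : bdE (uni M) = M.biUnion bdE := by
    ext e
    rw [mem_bdE_uni hM]; simp
  rw [this, Finset.card_biUnion]
  intro A hA B hB hne
  exact outer_bdE_disj (hM hA) (hM hB) hne

lemma card_uni {L : Finset Site} {M : Finset (Finset Site)} (hM : M ⊆ outer L) :
    (uni M).card = ∑ A ∈ M, A.card := by
  rw [uni, Finset.card_biUnion]
  · rfl
  intro A hA B hB hne
  exact outer_disj (hM hA) (hM hB) hne

end TopologyPart3

noncomputable section CountingPart
open scoped Classical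

/-- Step labels. -/
abbrev Kst := Bool × Bool × Bool

/-- Edges of a plaquette, labelled. -/
def pEdge (p : Site) (c d : Bool) : LEdge :=
  if c then (if d then (p, true) else (p, false))
  else (if d then (p + (1, 0), false) else (p + (0, 1), true))

/-- Labelled neighbours of an edge. -/
def nbE (e : LEdge) (i : Kst) : LEdge :=
  pEdge (if i.1 then e.1 else e.1 - (if e.2 then (0, 1) else (1, 0))) i.2.1 i.2.2

lemma exists_nbE {e e' : LEdge} (h : padj e e') : ∃ i, nbE e i = e' := by
  obtain ⟨p, h1, h2⟩ := h
  have h3 : ∃ b : Bool, (if b then e.1 else e.1 - (if e.2 then (0, 1) else (1, 0))) = p := by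
    simp only [plaq, Finset.mem_insert, Finset.mem_singleton] at h1
    rcases h1 with rfl | rfl | rfl | rfl
    · exact ⟨true, by simp⟩
    · exact ⟨true, by simp⟩
    · exact ⟨false, by simp⟩
    · exact ⟨false, by simp⟩
  obtain ⟨b, hb⟩ := h3
  simp only [plaq, Finset.mem_insert, Finset.mem_singleton] at h2
  rcases h2 with rfl | rfl | rfl | rfl
  · exact ⟨(b, true, true), by simp [nbE, hb, pEdge]⟩
  · exact ⟨(b, true, false), by simp [nbE, hb, pEdge]⟩
  · exact ⟨(b, false, true), by simp [nbE, hb, pEdge]⟩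
  · exact ⟨(b, false, false), by simp [nbE, hb, pEdge]⟩

/-- Edges visited by a walk. -/
def visited : LEdge → List Kst → Finset LEdge
  | e, [] => {e}
  | e, i :: l => insert e (visited (nbE e i) l)

lemma self_mem_visited (e : LEdge) (l : List Kst) : e ∈ visited e l := by
  cases l <;> simp [visited]

lemma visited_grow {u v : LEdge} (huv : padj u v) (l : List Kst) : ∀ e, u ∈ visited e l →
    ∃ l' : List Kst, l'.length = l.length + 2 ∧ visited e l' = insert v (visited e l) := by
  obtain ⟨i, hi⟩ := exists_nbE huv
  obtain ⟨j, hj⟩ := exists_nbE huv.symm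
  have h0 : ∀ l : List Kst, ∃ l' : List Kst, l'.length = l.length + 2 ∧
      visited u l' = insert v (visited u l) := by
    intro l
    refine ⟨i :: j :: l, by simp, ?_⟩
    simp only [visited, hi, hj]
    rw [Finset.insert_comm, Finset.insert_eq_of_mem (self_mem_visited u l)]
  induction l with
  | nil =>
    intro e he
    simp only [visited, Finset.mem_singleton] at he
    subst he
    exact h0 []
  | cons k l ih =>
    intro e he
    by_cases hue : u = e
    · subst hue; exact h0 _
    · simp only [visited, Finset.mem_insert, hue, false_or] at he
      obtain ⟨l', h1, h2⟩ := ih _ he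
      refine ⟨k :: l', by simp [h1], ?_⟩
      simp only [visited, h2]
      rw [Finset.insert_comm]

lemma exists_walk {S : Finset LEdge} (hS : PConn S) {e : LEdge} (he : e ∈ S) :
    ∃ l : List Kst, l.length = 2 * (S.card - 1) ∧ visited e l = S := by
  have key : ∀ k : ℕ, k + 1 ≤ S.card → ∃ l : List Kst, l.length = 2 * k ∧
      visited e l ⊆ S ∧ (visited e l).card = k + 1 := by
    intro k
    induction k with
    | zero => intro _; exact ⟨[], by simp [visited, he]⟩
    | succ k ih =>
      intro hk
      obtain ⟨l, h1, h2, h3⟩ := ih (by omega)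
      have : ∃ u ∈ visited e l, ∃ v ∈ S, v ∉ visited e l ∧ padj u v := by
        by_contra hcon
        push Not at hcon
        have hsub : S ⊆ visited e l := by
          intro b hb
          refine hS.const (Q := fun a => a ∈ visited e l) ?_ he hb (self_mem_visited _ _)
          intro a ha b hb hab hq
          by_contra hb'
          exact hcon a hq b hb hb' hab
        have := Finset.card_le_card hsub
        omega
      obtain ⟨u, hu, v, hv, hv', huv⟩ := this
      obtain ⟨l', h4, h5⟩ := visited_grow huv l e hu
      refine ⟨l', by omega, ?_, ?_⟩
      · rw [h5]; exact Finset.insert_subset hv h2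
      · rw [h5, Finset.card_insert_of_notMem hv', h3]
  have hpos : 0 < S.card := Finset.card_pos.2 ⟨e, he⟩
  obtain ⟨l, h1, h2, h3⟩ := key (S.card - 1) (by omega)
  exact ⟨l, h1, Finset.eq_of_subset_of_card_le h2 (by omega)⟩

lemma hor_right {A : Finset Site} {x : Site} (hx : x ∈ A) :
    ∃ a : ℤ, x.1 ≤ a ∧ ((a, x.2), true) ∈ bdE A := by
  obtain ⟨k, h1, h2⟩ := right_exit A hx
  refine ⟨x.1 + k, by omega, ?_⟩
  rw [mem_bdE]
  have := h1 k le_rfl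
  simp [eHead, this, h2]

lemma hor_left {A : Finset Site} {x : Site} (hx : x ∈ A) :
    ∃ a : ℤ, a < x.1 ∧ ((a, x.2), true) ∈ bdE A := by
  obtain ⟨k, h1, h2⟩ := exit_dir A (-1, 0) (by simp) hx
  refine ⟨x.1 - k - 1, by omega, ?_⟩
  rw [mem_bdE]
  have := h1 k le_rfl
  have e1 : x + k • ((-1, 0) : Site) = (x.1 - k - 1 + 1, x.2) := by ext <;> simp <;> ring
  have e2 : x + (k + 1) • ((-1, 0) : Site) = (x.1 - k - 1, x.2) := by ext <;> simp; ring
  rw [e1] at this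
  rw [e2] at h2
  simp [eHead, h2]
  simpa using this

lemma ver_up {A : Finset Site} {x : Site} (hx : x ∈ A) :
    ∃ a : ℤ, x.2 ≤ a ∧ ((x.1, a), false) ∈ bdE A := by
  obtain ⟨k, h1, h2⟩ := exit_dir A (0, 1) (by simp) hx
  refine ⟨x.2 + k, by omega, ?_⟩
  rw [mem_bdE]
  have := h1 k le_rfl
  have e1 : x + k • ((0, 1) : Site) = (x.1, x.2 + k) := by ext <;> simp
  have e2 : x + (k + 1) • ((0, 1) : Site) = (x.1, x.2 + k + 1) := by ext <;> simp; ring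
  rw [e1] at this
  rw [e2] at h2
  simp [eHead, h2, this]

lemma ver_down {A : Finset Site} {x : Site} (hx : x ∈ A) :
    ∃ a : ℤ, a < x.2 ∧ ((x.1, a), false) ∈ bdE A := by
  obtain ⟨k, h1, h2⟩ := exit_dir A (0, -1) (by simp) hx
  refine ⟨x.2 - k - 1, by omega, ?_⟩
  rw [mem_bdE]
  have := h1 k le_rfl
  have e1 : x + k • ((0, -1) : Site) = (x.1, x.2 - k - 1 + 1) := by ext <;> simp <;> ring
  have e2 : x + (k + 1) • ((0, -1) : Site) = (x.1, x.2 - k - 1) := by ext <;> simp; ring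
  rw [e1] at this
  rw [e2] at h2
  simp [eHead, h2]
  simpa using this

lemma four_le_bdE {A : Finset Site} (hA : A.Nonempty) : 4 ≤ (bdE A).card := by
  obtain ⟨x, hx⟩ := hA
  obtain ⟨a, ha, h1⟩ := hor_right hx
  obtain ⟨b, hb, h2⟩ := hor_left hx
  obtain ⟨c, hc, h3⟩ := ver_up hx
  obtain ⟨d, hd, h4⟩ := ver_down hx
  have hs : ({((a, x.2), true), ((b, x.2), true), ((x.1, c), false), ((x.1, d), false)} :
      Finset LEdge) ⊆ bdE A := by
    intro e he
    simp only [Finset.mem_insert, Finset.mem_singleton] at he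
    rcases he with rfl | rfl | rfl | rfl <;> assumption
  have hab : a ≠ b := by omega
  have hcd : c ≠ d := by omega
  refine le_trans ?_ (Finset.card_le_card hs)
  rw [Finset.card_insert_of_notMem, Finset.card_insert_of_notMem, Finset.card_insert_of_notMem,
    Finset.card_singleton] <;> simp [hab, hcd]

lemma six_le_bdE {A : Finset Site} (hA : 2 ≤ A.card) : 6 ≤ (bdE A).card := by
  obtain ⟨x, hx, y, hy, hxy⟩ := Finset.one_lt_card.1 (show 1 < A.card by omega)
  obtain ⟨a, ha, h1⟩ := hor_right hx
  obtain ⟨b, hb, h2⟩ := hor_left hx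
  obtain ⟨c, hc, h3⟩ := ver_up hx
  obtain ⟨d, hd, h4⟩ := ver_down hx
  have hab : a ≠ b := by omega
  have hcd : c ≠ d := by omega
  by_cases h : x.1 = y.1
  · have h' : x.2 ≠ y.2 := fun h2 => hxy (Prod.ext h h2)
    obtain ⟨a', ha', h5⟩ := hor_right hy
    obtain ⟨b', hb', h6⟩ := hor_left hy
    have hab' : a' ≠ b' := by omega
    have hs : ({((a', y.2), true), ((b', y.2), true), ((a, x.2), true), ((b, x.2), true),
        ((x.1, c), false), ((x.1, d), false)} : Finset LEdge) ⊆ bdE A := by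
      intro e he
      simp only [Finset.mem_insert, Finset.mem_singleton] at he
      rcases he with rfl | rfl | rfl | rfl | rfl | rfl <;> assumption
    refine le_trans ?_ (Finset.card_le_card hs)
    rw [Finset.card_insert_of_notMem, Finset.card_insert_of_notMem, Finset.card_insert_of_notMem,
      Finset.card_insert_of_notMem, Finset.card_insert_of_notMem,
      Finset.card_singleton] <;> simp [hab, hcd, hab', Ne.symm h']
  · obtain ⟨c', hc', h5⟩ := ver_up hy
    obtain ⟨d', hd', h6⟩ := ver_down hy
    have hcd' : c' ≠ d' := by omega
    have hs : ({((a, x.2), true), ((b, x.2), true), ((y.1, c'), false), ((y.1, d'), false),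
        ((x.1, c), false), ((x.1, d), false)} : Finset LEdge) ⊆ bdE A := by
      intro e he
      simp only [Finset.mem_insert, Finset.mem_singleton] at he
      rcases he with rfl | rfl | rfl | rfl | rfl | rfl <;> assumption
    refine le_trans ?_ (Finset.card_le_card hs)
    rw [Finset.card_insert_of_notMem, Finset.card_insert_of_notMem, Finset.card_insert_of_notMem,
      Finset.card_insert_of_notMem, Finset.card_insert_of_notMem,
      Finset.card_singleton] <;> simp [hab, hcd, hcd', Ne.symm h]

lemma card_le_bdE_sq (A : Finset Site) : A.card ≤ (bdE A).card * (bdE A).card := by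
  have h1 : ∀ x : Site, ∃ a : ℤ, x ∈ A → ((a, x.2), true) ∈ bdE A := fun x => by
    by_cases hx : x ∈ A
    · obtain ⟨a, _, h⟩ := hor_right hx; exact ⟨a, fun _ => h⟩
    · exact ⟨0, fun h => absurd h hx⟩
  have h2 : ∀ x : Site, ∃ a : ℤ, x ∈ A → ((x.1, a), false) ∈ bdE A := fun x => by
    by_cases hx : x ∈ A
    · obtain ⟨a, _, h⟩ := ver_up hx; exact ⟨a, fun _ => h⟩
    · exact ⟨0, fun h => absurd h hx⟩
  choose f hf using h1
  choose g hg using h2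
  rw [← Finset.card_product]
  apply Finset.card_le_card_of_injOn (fun x => (((f x, x.2), true), ((x.1, g x), false)))
  · intro x hx
    simp only [Finset.coe_product, Set.mem_prod, Finset.mem_coe]
    exact ⟨hf x hx, hg x hx⟩
  · intro x _ y _ h
    simp only [Prod.mk.injEq] at h
    exact Prod.ext h.2.1.1 h.1.1.2

lemma exists_exit (A : Finset Site) {x : Site} (hx : x ∈ A) :
    ∃ k : ℕ, k < (bdE A).card ∧ ((x.1 + k, x.2), true) ∈ bdE A := by
  obtain ⟨k, h1, h2⟩ := right_exit A hx
  refine ⟨k, ?_, ?_⟩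
  · have h3 : ∀ j : ℕ, ∃ a : ℤ, j ≤ k → ((x.1 + j, a), false) ∈ bdE A := fun j => by
      by_cases hj : j ≤ k
      · obtain ⟨a, _, h⟩ := ver_up (h1 j hj); exact ⟨a, fun _ => h⟩
      · exact ⟨0, fun h => absurd h hj⟩
    choose g hg using h3
    have : (Finset.range (k + 1)).card ≤ (bdE A).card := by
      apply Finset.card_le_card_of_injOn (fun j : ℕ => ((x.1 + j, g j), false))
      · intro j hj
        simp at hj
        exact hg j (by omega)
      · intro i _ j _ h
        simp only [Prod.mk.injEq] at h
        omega
    simp at this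
    omega
  · rw [mem_bdE]
    have := h1 k le_rfl
    simp [eHead, this, h2]

lemma count_fixed (x : Site) (n : ℕ) (Q : Finset (Finset Site))
    (hQ : ∀ A ∈ Q, ContC A ∧ x ∈ A ∧ (bdE A).card = n) : Q.card ≤ n * 64 ^ n := by
  have hcode : ∀ A : {A // A ∈ Q}, ∃ c : Fin n × List.Vector Kst (2 * (n - 1)),
      visited ((x.1 + (c.1 : ℕ), x.2), true) c.2.1 = bdE A.1 := by
    rintro ⟨A, hA⟩
    obtain ⟨h1, h2, h3⟩ := hQ A hA
    obtain ⟨k, hk, he⟩ := exists_exit A h2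
    obtain ⟨l, hl, hv⟩ := exists_walk h1.2 he
    rw [h3] at hk hl
    exact ⟨(⟨k, hk⟩, ⟨l, hl⟩), hv⟩
  choose c hc using hcode
  have hinj : Function.Injective c := by
    intro A B h
    apply Subtype.ext
    apply bdE_inj
    rw [← hc, ← hc, h]
  have := Fintype.card_le_of_injective c hinj
  rw [Fintype.card_coe, Fintype.card_prod, Fintype.card_fin, card_vector] at this
  refine this.trans ?_
  have h8 : Fintype.card Kst = 8 := by decide
  rw [h8]
  apply Nat.mul_le_mul_left
  calc 8 ^ (2 * (n - 1)) ≤ 8 ^ (2 * n) := Nat.pow_le_pow_right (by norm_num) (by omega)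
    _ = 64 ^ n := by rw [pow_mul]; norm_num

lemma cube_le (n : ℕ) : n * n * n ≤ 8 ^ n := by
  have h : n ≤ 2 ^ n := (Nat.lt_two_pow_self).le
  calc n * n * n ≤ 2 ^ n * 2 ^ n * 2 ^ n := by gcongr
    _ = 8 ^ n := by rw [← mul_pow, ← mul_pow]; norm_num

lemma count_sum (x : Site) (Q : Finset (Finset Site)) (hQ : ∀ A ∈ Q, ContC A ∧ x ∈ A) :
    ∑ A ∈ Q, (A.card : ℝ) * (1 / 1024 : ℝ) ^ (bdE A).card ≤ 2 := by
  obtain ⟨N, hN⟩ : ∃ N, ∀ A ∈ Q, (bdE A).card ∈ Finset.range N := by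
    refine ⟨∑ A ∈ Q, (bdE A).card + 1, fun A hA => ?_⟩
    have := Finset.single_le_sum (f := fun A : Finset Site => (bdE A).card)
      (fun _ _ => Nat.zero_le _) hA
    simp only [Finset.mem_range]
    omega
  rw [← Finset.sum_fiberwise_of_maps_to hN]
  calc _ ≤ ∑ n ∈ Finset.range N, (1 / 2 : ℝ) ^ n := by
        apply Finset.sum_le_sum
        intro n _
        have h1 : ∀ A ∈ Q.filter (fun A => (bdE A).card = n),
            (A.card : ℝ) * (1 / 1024 : ℝ) ^ (bdE A).card ≤ (n * n : ℕ) * (1 / 1024 : ℝ) ^ n := by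
          intro A hA
          rw [(Finset.mem_filter.1 hA).2]
          gcongr
          have := card_le_bdE_sq A
          rwa [(Finset.mem_filter.1 hA).2] at this
        refine (Finset.sum_le_card_nsmul _ _ _ h1).trans ?_
        rw [nsmul_eq_mul]
        have h2 := count_fixed x n (Q.filter (fun A => (bdE A).card = n)) (fun A hA => by
          have := Finset.mem_filter.1 hA
          exact ⟨(hQ A this.1).1, (hQ A this.1).2, this.2⟩)
        have h3 : (Q.filter (fun A => (bdE A).card = n)).card * (n * n) ≤ 512 ^ n := by
          calc _ ≤ (n * 64 ^ n) * (n * n) := by gcongr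
            _ = (n * n * n) * 64 ^ n := by ring
            _ ≤ 8 ^ n * 64 ^ n := by gcongr; exact cube_le n
            _ = 512 ^ n := by rw [← mul_pow]; norm_num
        calc _ = (((Q.filter (fun A => (bdE A).card = n)).card * (n * n) : ℕ) : ℝ) *
              (1 / 1024 : ℝ) ^ n := by push_cast; ring
          _ ≤ ((512 ^ n : ℕ) : ℝ) * (1 / 1024 : ℝ) ^ n := by gcongr
          _ = (1 / 2 : ℝ) ^ n := by
            push_cast; rw [← mul_pow]; norm_num
    _ ≤ 2 := by
        have := sum_geometric_two_le N
        simpa using this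

/-- Constants: for large `β` all contour sums are small. -/
lemma count_exp {β : ℝ} (hβ : 100 ≤ β) {m : ℕ} (x : Site) (Q : Finset (Finset Site))
    (hQ : ∀ A ∈ Q, ContC A ∧ x ∈ A ∧ m ≤ (bdE A).card) :
    ∑ A ∈ Q, (A.card : ℝ) * Real.exp (-β * (bdE A).card) ≤ 2 * (1024 * Real.exp (-β)) ^ m := by
  have hq : 1024 * Real.exp (-β) ≤ 1 := by
    have h1 : Real.exp (-β) ≤ Real.exp (-10 * Real.log 2) := by
      apply Real.exp_le_exp.2
      have := Real.log_two_lt_d9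
      linarith
    have h2 : Real.exp (-10 * Real.log 2) = 1 / 1024 := by
      have : (-10 : ℝ) * Real.log 2 = -(Real.log (2 ^ 10)) := by rw [Real.log_pow]; push_cast; ring
      rw [this, Real.exp_neg, Real.exp_log (by positivity)]; norm_num
    rw [h2] at h1
    linarith
  have hpos : 0 ≤ 1024 * Real.exp (-β) := by positivity
  have h1 : ∀ A ∈ Q, (A.card : ℝ) * Real.exp (-β * (bdE A).card) ≤
      (1024 * Real.exp (-β)) ^ m * ((A.card : ℝ) * (1 / 1024 : ℝ) ^ (bdE A).card) := by
    intro A hA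
    have e1 : Real.exp (-β * (bdE A).card) =
        (1024 * Real.exp (-β)) ^ (bdE A).card * (1 / 1024 : ℝ) ^ (bdE A).card := by
      rw [← mul_pow, mul_comm (-β), Real.exp_nat_mul]; congr 1; ring
    rw [e1]
    have := pow_le_pow_of_le_one hpos hq (hQ A hA).2.2
    calc _ = (1024 * Real.exp (-β)) ^ (bdE A).card * ((A.card : ℝ) * (1 / 1024 : ℝ) ^ (bdE A).card) := by ring
      _ ≤ _ := by gcongr
  refine (Finset.sum_le_sum h1).trans ?_
  rw [← Finset.mul_sum]
  have := count_sum x Q (fun A hA => ⟨(hQ A hA).1, (hQ A hA).2.1⟩)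
  calc _ ≤ (1024 * Real.exp (-β)) ^ m * 2 := by gcongr
    _ = _ := by ring

lemma exp_two_beta {β : ℝ} (hβ : 100 ≤ β) : (2 : ℝ) ^ 64 ≤ Real.exp (2 * β) := by
  have : (2 : ℝ) ^ 64 = Real.exp (64 * Real.log 2) := by
    have h : (64 : ℝ) * Real.log 2 = Real.log (2 ^ 64) := by rw [Real.log_pow]; push_cast; ring
    rw [h, Real.exp_log (by positivity)]
  rw [this]
  apply Real.exp_le_exp.2
  have := Real.log_two_lt_d9
  linarith

lemma count_four {β : ℝ} (hβ : 100 ≤ β) (x : Site) (Q : Finset (Finset Site))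
    (hQ : ∀ A ∈ Q, ContC A ∧ x ∈ A) :
    ∑ A ∈ Q, (A.card : ℝ) * Real.exp (-β * (bdE A).card) ≤ Real.exp (-2 * β) / 8 := by
  refine (count_exp hβ (m := 4) x Q (fun A hA => ⟨(hQ A hA).1, (hQ A hA).2, four_le_bdE ⟨x, (hQ A hA).2⟩⟩)).trans ?_
  have h := exp_two_beta hβ
  have e1 : Real.exp (-β) ^ 4 * Real.exp (2 * β) = Real.exp (-2 * β) := by
    rw [← Real.exp_nat_mul, ← Real.exp_add]; congr 1; push_cast; ring
  rw [mul_pow, ← e1]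
  have : 0 < Real.exp (-β) ^ 4 := by positivity
  nlinarith

lemma count_six {β : ℝ} (hβ : 100 ≤ β) (x : Site) (Q : Finset (Finset Site))
    (hQ : ∀ A ∈ Q, ContC A ∧ x ∈ A ∧ 2 ≤ A.card) :
    ∑ A ∈ Q, Real.exp (-β * (bdE A).card) ≤ Real.exp (-4 * β) / 2 := by
  have h0 := count_exp hβ (m := 6) x Q
    (fun A hA => ⟨(hQ A hA).1, (hQ A hA).2.1, six_le_bdE (hQ A hA).2.2⟩)
  have h1 : ∑ A ∈ Q, Real.exp (-β * (bdE A).card) ≤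
      ∑ A ∈ Q, (A.card : ℝ) * Real.exp (-β * (bdE A).card) := by
    apply Finset.sum_le_sum
    intro A hA
    have : (1 : ℝ) ≤ A.card := by
      have := (hQ A hA).2.2
      exact_mod_cast (by omega : 1 ≤ A.card)
    have := Real.exp_pos (-β * (bdE A).card)
    nlinarith
  refine (h1.trans h0).trans ?_
  have h := exp_two_beta hβ
  have e1 : Real.exp (-β) ^ 6 * Real.exp (2 * β) = Real.exp (-4 * β) := by
    rw [← Real.exp_nat_mul, ← Real.exp_add]; congr 1; push_cast; ring
  rw [mul_pow, ← e1]
  have : 0 < Real.exp (-β) ^ 6 := by positivity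
  nlinarith

end CountingPart

noncomputable section EnergyPart
open scoped Classical

/-- Integer energy. -/
def En (V : Finset Site) (ψ : Site → ℤ) : ℤ := ∑ e ∈ incE V, |ψ e.1 - ψ (eHead e)|

/-- Integer field. -/
def Fl (V : Finset Site) (ψ : Site → ℤ) : ℤ := ∑ v ∈ V, ψ v

lemma sum_incE (V : Finset Site) (g : LEdge → ℝ) :
    ∑ e ∈ incE V, g e = ∑ v ∈ V,
      ((if v + (1, 0) ∈ V then (1 : ℝ) / 2 else 1) * g (v, true) +
       (if v - (1, 0) ∈ V then (1 : ℝ) / 2 else 1) * g (v - (1, 0), true) +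
       (if v + (0, 1) ∈ V then (1 : ℝ) / 2 else 1) * g (v, false) +
       (if v - (0, 1) ∈ V then (1 : ℝ) / 2 else 1) * g (v - (0, 1), false)) := by
  let c : LEdge → ℝ := fun e => if e.1 ∈ V ∧ eHead e ∈ V then 1 / 2 else 1
  have h1 : ∀ e ∈ incE V, g e = (if e.1 ∈ V then c e * g e else 0) +
      (if eHead e ∈ V then c e * g e else 0) := by
    intro e he
    rw [mem_incE] at he
    by_cases a : e.1 ∈ V <;> by_cases b : eHead e ∈ V <;> simp [a, b, c] at he ⊢
    ring
  rw [Finset.sum_congr rfl h1, Finset.sum_add_distrib, ← Finset.sum_filter, ← Finset.sum_filter]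
  have h2 : (incE V).filter (fun e => e.1 ∈ V) = V ×ˢ Finset.univ := by
    ext e
    simp [mem_incE]; tauto
  have h3 : (incE V).filter (fun e => eHead e ∈ V) =
      (V ×ˢ (Finset.univ : Finset Bool)).image
        (fun q => (q.1 - (if q.2 then (1, 0) else (0, 1)), q.2)) := by
    ext ⟨v, b⟩
    simp only [mem_incE, Finset.mem_filter, Finset.mem_image, Finset.mem_product, Finset.mem_univ,
      and_true, Prod.mk.injEq]
    constructor
    · rintro ⟨_, h⟩
      exact ⟨(eHead (v, b), b), h, by simp [eHead], rfl⟩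
    · rintro ⟨q, hq, h, rfl⟩
      have : eHead (v, q.2) = q.1 := by rw [← h]; simp [eHead]
      rw [this]; exact ⟨Or.inr hq, hq⟩
  rw [h2, h3, Finset.sum_image, Finset.sum_product, Finset.sum_product, ← Finset.sum_add_distrib]
  · apply Finset.sum_congr rfl
    intro v hv
    simp only [Fintype.sum_bool, c, eHead]
    simp [hv]
    ring
  · rintro ⟨v, b⟩ _ ⟨v', b'⟩ _ h
    simp only [Prod.mk.injEq] at h
    obtain ⟨h1, rfl⟩ := h
    simp at h1
    rw [h1]

lemma sosEnergy_eq (V : Finset Site) (ψ : Site → ℤ) : sosEnergy V ψ = (En V ψ : ℝ) := by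
  unfold En
  push_cast
  rw [sum_incE, sosEnergy]
  apply Finset.sum_congr rfl
  intro v _
  have : ∀ f : Site → ℝ, ∑ d ∈ dirs, f d = f (1, 0) + f (-1, 0) + f (0, 1) + f (0, -1) := by
    intro f
    unfold dirs
    rw [Finset.sum_insert (by decide), Finset.sum_insert (by decide), Finset.sum_insert (by decide),
      Finset.sum_singleton]
    ring
  rw [this]
  have e1 : v + (-1, 0) = v - (1, 0) := by ext <;> simp [sub_eq_add_neg]
  have e2 : v + (0, -1) = v - (0, 1) := by ext <;> simp [sub_eq_add_neg]
  rw [e1, e2]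
  have a1 := abs_sub_comm ((ψ v : ℝ)) (ψ (v - (1, 0)))
  have a2 := abs_sub_comm ((ψ v : ℝ)) (ψ (v - (0, 1)))
  simp only [a1, a2, eHead, if_true, sub_add_cancel]
  simp

lemma sosField_eq (V : Finset Site) (ψ : Site → ℤ) : sosField V ψ = (Fl V ψ : ℝ) := by
  simp [sosField, Fl]

/-- Weight in `[0,∞]`. -/
def wt (β lam : ℝ) (V : Finset Site) (ψ : Site → ℤ) : ENNReal := ENNReal.ofReal (sosWt β lam V ψ)

/-- exponential in `[0,∞]`. -/
def ex (x : ℝ) : ENNReal := ENNReal.ofReal (Real.exp x)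

lemma ex_add (x y : ℝ) : ex (x + y) = ex x * ex y := by
  rw [ex, Real.exp_add, ENNReal.ofReal_mul (Real.exp_pos _).le]; rfl

lemma ex_zero : ex 0 = 1 := by simp [ex]

lemma ex_mono {x y : ℝ} (h : x ≤ y) : ex x ≤ ex y :=
  ENNReal.ofReal_le_ofReal (Real.exp_le_exp.2 h)

lemma ex_ne_top (x : ℝ) : ex x ≠ ⊤ := ENNReal.ofReal_ne_top

lemma ex_ne_zero (x : ℝ) : ex x ≠ 0 := by
  simp [ex, Real.exp_pos]

lemma ex_nat_mul (n : ℕ) (x : ℝ) : ex (n * x) = ex x ^ n := by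
  rw [ex, Real.exp_nat_mul, ENNReal.ofReal_pow (Real.exp_pos _).le]; rfl

lemma ex_sum {ι : Type*} (s : Finset ι) (f : ι → ℝ) : ex (∑ i ∈ s, f i) = ∏ i ∈ s, ex (f i) := by
  induction s using Finset.induction_on with
  | empty => simp [ex_zero]
  | insert a s ha ih => rw [Finset.sum_insert ha, Finset.prod_insert ha, ex_add, ih]

lemma wt_eq (β lam : ℝ) (V : Finset Site) (ψ : Site → ℤ) :
    wt β lam V ψ = ex (-(β * En V ψ + lam * Fl V ψ)) := by
  rw [wt, sosWt, sosEnergy_eq, sosField_eq]; rfl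

/-- Restricted partition function. -/
def ZZ (β lam : ℝ) (V : Finset Site) (K : Set (Site → ℤ)) : ENNReal :=
  ∑' ψ, K.indicator (wt β lam V) ψ

lemma ZZ_mono {β lam : ℝ} {V : Finset Site} {K K' : Set (Site → ℤ)} (h : K ⊆ K') :
    ZZ β lam V K ≤ ZZ β lam V K' :=
  ENNReal.tsum_le_tsum fun ψ => Set.indicator_le_indicator_of_subset h (fun _ => zero_le) ψ

lemma tsum_le_of_inj {α β : Type*} {f : α → ENNReal} {F : β → ENNReal} (i : α → β)
    (hi : Set.InjOn i (Function.support f)) (h : ∀ x, f x ≠ 0 → f x ≤ F (i x)) :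
    ∑' x, f x ≤ ∑' y, F y := by
  rw [← tsum_subtype_support f]
  calc ∑' x : Function.support f, f x ≤ ∑' x : Function.support f, F (i x) :=
        ENNReal.tsum_le_tsum fun x => h x.1 x.2
    _ ≤ ∑' y, F y := ENNReal.tsum_comp_le_tsum_of_injective
        (f := fun x : Function.support f => i x) (fun a b hab => Subtype.ext (hi a.2 b.2 hab)) F

/-- Comparison by an injective map. -/
lemma ZZ_le_of_map {β lam : ℝ} {V : Finset Site} {K K' : Set (Site → ℤ)} (c : ENNReal)
    (i : (Site → ℤ) → (Site → ℤ)) (hi : Set.InjOn i K) (hK : ∀ ψ ∈ K, i ψ ∈ K')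
    (hw : ∀ ψ ∈ K, wt β lam V ψ ≤ c * wt β lam V (i ψ)) :
    ZZ β lam V K ≤ c * ZZ β lam V K' := by
  unfold ZZ
  rw [← ENNReal.tsum_mul_left]
  apply tsum_le_of_inj i
  · exact hi.mono (fun ψ hψ => by
      by_contra h
      simp [h] at hψ)
  · intro ψ hψ
    have h : ψ ∈ K := by
      by_contra h
      simp [h] at hψ
    rw [Set.indicator_of_mem h, Set.indicator_of_mem (hK ψ h)]
    exact hw ψ h

lemma ZZ_le_sum {β lam : ℝ} {V : Finset Site} {ι : Type*} (s : Finset ι) (K : Set (Site → ℤ))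
    (K' : ι → Set (Site → ℤ)) (h : ∀ ψ ∈ K, ∃ i ∈ s, ψ ∈ K' i) :
    ZZ β lam V K ≤ ∑ i ∈ s, ZZ β lam V (K' i) := by
  unfold ZZ
  rw [← Summable.tsum_finsetSum (fun i _ => ENNReal.summable)]
  apply ENNReal.tsum_le_tsum
  intro ψ
  by_cases hψ : ψ ∈ K
  · obtain ⟨i, hi, hiK⟩ := h ψ hψ
    rw [Set.indicator_of_mem hψ]
    refine le_trans ?_ (Finset.single_le_sum (f := fun i => (K' i).indicator (wt β lam V) ψ)
      (fun _ _ => zero_le) hi)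
    simp [Set.indicator_of_mem hiK]
  · simp [hψ]

lemma ZZ_union_disj {β lam : ℝ} {V : Finset Site} {K K' : Set (Site → ℤ)} (h : Disjoint K K') :
    ZZ β lam V (K ∪ K') = ZZ β lam V K + ZZ β lam V K' := by
  unfold ZZ
  rw [← ENNReal.tsum_add]
  congr 1
  ext ψ
  rw [Set.indicator_union_of_disjoint h]

/-- inside part -/
def gIn (B : Finset Site) (c : ℤ) (ψ : Site → ℤ) : Site → ℤ := fun x => if x ∈ B then ψ x else c

/-- outside part -/
def gOut (B : Finset Site) (c : ℤ) (ψ : Site → ℤ) : Site → ℤ := fun x => if x ∈ B then c else ψ x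

lemma sum_bdE {B V : Finset Site} (hBV : B ⊆ V) :
    (∑ e ∈ incE V, if e ∈ bdE B then (1 : ℤ) else 0) = (bdE B).card := by
  rw [← Finset.sum_filter, Finset.sum_const, nsmul_eq_mul, mul_one]
  congr 2
  ext e
  simp only [Finset.mem_filter, mem_incE, mem_bdE, and_iff_right_iff_imp]
  intro h
  by_contra hcon
  push Not at hcon
  exact h ⟨fun h' => absurd (hBV h') hcon.1, fun h' => absurd (hBV h') hcon.2⟩

lemma En_shift {U V : Finset Site} (hUV : U ⊆ V) {ψ φ : Site → ℤ}
    (h : ∀ e ∈ incE V, |ψ e.1 - ψ (eHead e)| = |φ e.1 - φ (eHead e)| +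
      if e ∈ bdE U then 1 else 0) : En V ψ = En V φ + (bdE U).card := by
  rw [← sum_bdE hUV, En, En, ← Finset.sum_add_distrib]
  exact Finset.sum_congr rfl h

/-- crossing condition -/
def crossOK (B : Finset Site) (c' c : ℤ) (ψ : Site → ℤ) : Prop :=
  ∀ e ∈ bdE B, (e.1 ∈ B → ψ e.1 ≤ c' ∧ c ≤ ψ (eHead e)) ∧
    (e.1 ∉ B → ψ (eHead e) ≤ c' ∧ c ≤ ψ e.1)

lemma En_glue {B V : Finset Site} (hBV : B ⊆ V) {c' c : ℤ} (hc : c' ≤ c) {ψ : Site → ℤ}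
    (h : crossOK B c' c ψ) :
    En V ψ = En B (gIn B c' ψ) + En V (gOut B c ψ) + (c - c') * (bdE B).card := by
  have h1 : En B (gIn B c' ψ) = ∑ e ∈ incE V, if e ∈ incE B then
      |gIn B c' ψ e.1 - gIn B c' ψ (eHead e)| else 0 := by
    rw [← Finset.sum_filter, En]
    apply Finset.sum_congr _ (fun _ _ => rfl)
    ext e
    simp only [Finset.mem_filter, mem_incE]
    have := @hBV e.1
    have := @hBV (eHead e)
    tauto
  rw [h1, ← sum_bdE hBV, Finset.mul_sum, En, En, ← Finset.sum_add_distrib,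
    ← Finset.sum_add_distrib]
  apply Finset.sum_congr rfl
  intro e _
  by_cases a : e.1 ∈ B <;> by_cases b : eHead e ∈ B
  · have : e ∉ bdE B := by rw [mem_bdE]; tauto
    have h2 : e ∈ incE B := by rw [mem_incE]; tauto
    simp [this, h2, gIn, gOut, a, b]
  · have he : e ∈ bdE B := by rw [mem_bdE]; tauto
    have h2 : e ∈ incE B := by rw [mem_incE]; tauto
    have h3 := (h e he).1 a
    simp only [he, h2, gIn, gOut, a, b, if_true, if_false]
    rw [abs_of_nonpos (by omega), abs_of_nonpos (by omega), abs_of_nonpos (by omega)]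
    ring
  · have he : e ∈ bdE B := by rw [mem_bdE]; tauto
    have h2 : e ∈ incE B := by rw [mem_incE]; tauto
    have h3 := (h e he).2 a
    simp only [he, h2, gIn, gOut, a, b, if_true, if_false]
    rw [abs_of_nonneg (by omega), abs_of_nonneg (by omega), abs_of_nonneg (by omega)]
    ring
  · have : e ∉ bdE B := by rw [mem_bdE]; tauto
    have h2 : e ∉ incE B := by rw [mem_incE]; tauto
    simp [this, h2, gOut, a, b]

lemma Fl_glue {B V : Finset Site} (hBV : B ⊆ V) {c' c : ℤ} {ψ : Site → ℤ} :
    Fl V ψ = Fl B (gIn B c' ψ) + Fl V (gOut B c ψ) - c * B.card := by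
  unfold Fl gIn gOut
  have h0 : ∑ v ∈ B, (if v ∈ B then ψ v else c') = ∑ v ∈ B, ψ v :=
    Finset.sum_congr rfl (fun v hv => if_pos hv)
  rw [h0, Finset.sum_ite]
  have h1 : V.filter (fun x => x ∈ B) = B := by
    ext x; simp; exact fun h => hBV h
  have h2 : V.filter (fun x => x ∉ B) = V \ B := by
    ext x; simp
  rw [h1, h2, Finset.sum_const, ← Finset.sum_sdiff hBV, nsmul_eq_mul]
  ring

lemma wt_glue {β lam : ℝ} {B V : Finset Site} (hBV : B ⊆ V) {c' c : ℤ} (hc : c' ≤ c)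
    {ψ : Site → ℤ} (h : crossOK B c' c ψ) :
    wt β lam V ψ = ex (lam * c * B.card - β * (c - c') * (bdE B).card) *
      (wt β lam B (gIn B c' ψ) * wt β lam V (gOut B c ψ)) := by
  rw [wt_eq, wt_eq, wt_eq, ← ex_add, ← ex_add, En_glue hBV hc h, Fl_glue (c' := c') (c := c) hBV]
  congr 1
  push_cast
  ring

lemma tsum_glue (B : Finset Site) (c' c : ℤ) (F G : (Site → ℤ) → ENNReal)
    (hF : ∀ f, F f ≠ 0 → ∀ x ∉ B, f x = c') (hG : ∀ g, G g ≠ 0 → ∀ x ∈ B, g x = c) :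
    ∑' ψ, F (gIn B c' ψ) * G (gOut B c ψ) = (∑' f, F f) * ∑' g, G g := by
  rw [← ENNReal.tsum_mul_right]
  simp_rw [← ENNReal.tsum_mul_left]
  rw [← ENNReal.tsum_prod]
  have hinj : Function.Injective (fun ψ : Site → ℤ => (gIn B c' ψ, gOut B c ψ)) := by
    intro ψ φ h
    simp only [Prod.mk.injEq] at h
    funext x
    have h1 := congrFun h.1 x
    have h2 := congrFun h.2 x
    simp only [gIn, gOut] at h1 h2
    by_cases hx : x ∈ B <;> simp [hx] at h1 h2 <;> assumption
  refine hinj.tsum_eq (f := fun q : (Site → ℤ) × (Site → ℤ) => F q.1 * G q.2) ?_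
  rintro ⟨f, g⟩ hq
  simp only [Function.mem_support, ne_eq, mul_eq_zero, not_or] at hq
  refine ⟨gIn B 0 f + gOut B 0 g, ?_⟩
  simp only [Prod.mk.injEq]
  constructor <;> funext x <;> by_cases hx : x ∈ B <;> simp [gIn, gOut, hx]
  · exact (hF f hq.1 x hx).symm
  · exact (hG g hq.2 x hx).symm

lemma ZZ_glue {β lam : ℝ} {B V : Finset Site} (hBV : B ⊆ V) {c' c : ℤ} (hc : c' ≤ c)
    (Kin Kout : Set (Site → ℤ)) (hin : ∀ f ∈ Kin, ∀ x ∉ B, f x = c')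
    (hout : ∀ g ∈ Kout, ∀ x ∈ B, g x = c)
    (hcr : ∀ ψ, gIn B c' ψ ∈ Kin → gOut B c ψ ∈ Kout → crossOK B c' c ψ) :
    ZZ β lam V {ψ | gIn B c' ψ ∈ Kin ∧ gOut B c ψ ∈ Kout} =
      ex (lam * c * B.card - β * (c - c') * (bdE B).card) *
        (ZZ β lam B Kin * ZZ β lam V Kout) := by
  unfold ZZ
  rw [← tsum_glue B c' c, ← ENNReal.tsum_mul_left]
  · congr 1
    ext ψ
    by_cases h1 : gIn B c' ψ ∈ Kin <;> by_cases h2 : gOut B c ψ ∈ Kout <;>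
      simp only [Set.indicator, Set.mem_setOf_eq, h1, h2, and_self, if_true, if_false, and_true,
        and_false, mul_zero, zero_mul]
    exact wt_glue hBV hc (hcr ψ h1 h2)
  · intro f hf
    apply hin f
    by_contra h
    simp [h] at hf
  · intro g hg
    apply hout g
    by_contra h
    simp [h] at hg

/-- Minus configurations. -/
def Mi (V : Finset Site) (h : ℤ) : Set (Site → ℤ) := signedConfigs V (constSign .minus) h

/-- Plus configurations. -/
def Pl (V : Finset Site) (h : ℤ) : Set (Site → ℤ) := signedConfigs V (constSign .plus) h

lemma mem_innerBdry {V : Finset Site} {v : Site} :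
    v ∈ innerBdry V ↔ v ∈ V ∧ ∃ e ∈ bdE V, v = e.1 ∨ v = eHead e := by
  simp only [innerBdry, Finset.mem_filter]
  apply and_congr_right
  intro hv
  have h00 : v + (0, 0) = v := by ext <;> simp
  constructor
  · rintro ⟨d, hd, hvd⟩
    simp only [dirs, Finset.mem_insert, Finset.mem_singleton] at hd
    rcases hd with rfl | rfl | rfl | rfl
    · exact ⟨(v, true), by rw [mem_bdE]; simpa [eHead, hv] using hvd, Or.inl rfl⟩
    · refine ⟨(v + (-1, 0), true), ?_, Or.inr ?_⟩
      · rw [mem_bdE]; simpa [eHead, hv, add_assoc, h00] using hvd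
      · simp [eHead, add_assoc, h00]
    · exact ⟨(v, false), by rw [mem_bdE]; simpa [eHead, hv] using hvd, Or.inl rfl⟩
    · refine ⟨(v + (0, -1), false), ?_, Or.inr ?_⟩
      · rw [mem_bdE]; simpa [eHead, hv, add_assoc, h00] using hvd
      · simp [eHead, add_assoc, h00]
  · rintro ⟨⟨u, b⟩, he, rfl | rfl⟩
    · rw [mem_bdE] at he
      simp only [hv, true_iff] at he
      refine ⟨if b then (1, 0) else (0, 1), ?_, ?_⟩
      · cases b <;> simp [dirs]
      · exact he
    · rw [mem_bdE] at he
      simp only [hv, iff_true] at he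
      refine ⟨if b then (-1, 0) else (0, -1), ?_, ?_⟩
      · cases b <;> simp [dirs]
      · convert he using 2
        cases b <;> simp [eHead, add_assoc]

lemma innerBdry_nonempty {V : Finset Site} (hV : V.Nonempty) : (innerBdry V).Nonempty := by
  obtain ⟨e, he⟩ := contC_bdE_nonempty hV
  have h := mem_bdE.1 he
  by_cases h1 : e.1 ∈ V
  · exact ⟨e.1, mem_innerBdry.2 ⟨h1, e, he, Or.inl rfl⟩⟩
  · exact ⟨eHead e, mem_innerBdry.2 ⟨by tauto, e, he, Or.inr rfl⟩⟩

lemma mem_Mi {V : Finset Site} {h : ℤ} {ψ : Site → ℤ} : ψ ∈ Mi V h ↔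
    (∀ x, x ∉ V → ψ x = h) ∧ (∀ v ∈ V, 0 ≤ ψ v) ∧ ∀ v ∈ innerBdry V, ψ v ≤ h := Iff.rfl

lemma mem_Pl {V : Finset Site} {h : ℤ} {ψ : Site → ℤ} : ψ ∈ Pl V h ↔
    (∀ x, x ∉ V → ψ x = h) ∧ (∀ v ∈ V, 0 ≤ ψ v) ∧ ∀ v ∈ innerBdry V, h ≤ ψ v := Iff.rfl

lemma Zsos_eq_ZZ (β lam : ℝ) (η : Site → BSign) (h : ℤ) (V : Finset Site) :
    Zsos β lam η h V = (ZZ β lam V (signedConfigs V η h)).toReal := by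
  have hp : ∀ ψ, 0 ≤ sosWt β lam V ψ := fun ψ => (Real.exp_pos _).le
  rw [ZZ, ENNReal.tsum_toReal_eq]
  · unfold Zsos
    congr 1
    ext ψ
    by_cases hψ : ψ ∈ signedConfigs V η h
    · simp [hψ, wt, hp]
    · simp [hψ]
  · intro ψ
    by_cases hψ : ψ ∈ signedConfigs V η h <;> simp [hψ, wt]

lemma ratio_le_one {a b : ENNReal} (h : a ≤ b) : a.toReal / b.toReal ≤ 1 := by
  by_cases hb : b = ⊤
  · simp [hb]
  · exact div_le_one_of_le₀ (ENNReal.toReal_mono hb h) ENNReal.toReal_nonneg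

end EnergyPart

noncomputable section XiPart
open scoped Classical

/-- Families of pairwise disjoint members of `Q` inside `U`. -/
def fam (Q : Finset (Finset Site)) (U : Finset Site) : Finset (Finset (Finset Site)) :=
  Q.powerset.filter fun M => (∀ A ∈ M, A ⊆ U) ∧ ∀ A ∈ M, ∀ B ∈ M, A ≠ B → Disjoint A B

lemma mem_fam {Q : Finset (Finset Site)} {U : Finset Site} {M : Finset (Finset Site)} :
    M ∈ fam Q U ↔ M ⊆ Q ∧ (∀ A ∈ M, A ⊆ U) ∧ ∀ A ∈ M, ∀ B ∈ M, A ≠ B → Disjoint A B := by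
  simp [fam]

lemma sum_le_sum_inj {α β : Type*} (s : Finset α) (t : Finset β) (f : α → ENNReal)
    (g : β → ENNReal) (i : α → β) (hi : Set.InjOn i s) (hm : ∀ a ∈ s, i a ∈ t)
    (h : ∀ a ∈ s, f a ≤ g (i a)) : ∑ a ∈ s, f a ≤ ∑ b ∈ t, g b := by
  calc ∑ a ∈ s, f a ≤ ∑ a ∈ s, g (i a) := Finset.sum_le_sum h
    _ = ∑ b ∈ s.image i, g b := (Finset.sum_image hi).symm
    _ ≤ ∑ b ∈ t, g b := Finset.sum_le_sum_of_subset (by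
        intro b hb
        obtain ⟨a, ha, rfl⟩ := Finset.mem_image.1 hb
        exact hm a ha)

lemma Xi_le_one (Q : Finset (Finset Site)) (w : Finset Site → ENNReal) (q : ENNReal)
    (hne : ∀ A ∈ Q, A.Nonempty)
    (hw : ∀ x, q + ∑ A ∈ Q.filter (fun A => x ∈ A), w A ≤ 1) (U : Finset Site) :
    ∑ M ∈ fam Q U, (∏ A ∈ M, w A) * q ^ (U \ uni M).card ≤ 1 := by
  induction U using Finset.strongInduction with
  | H U ih =>
  rcases U.eq_empty_or_nonempty with rfl | ⟨x, hx⟩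
  · have : fam Q ∅ = {∅} := by
      ext M
      rw [mem_fam, Finset.mem_singleton]
      constructor
      · rintro ⟨h1, h2, _⟩
        rw [Finset.eq_empty_iff_forall_notMem]
        intro A hA
        have := hne A (h1 hA)
        rw [Finset.subset_empty.1 (h2 A hA)] at this
        simp at this
      · rintro rfl
        simp
    rw [this]; simp
  · let t : Finset (Finset Site) → ENNReal := fun M => (∏ A ∈ M, w A) * q ^ (U \ uni M).card
    change ∑ M ∈ fam Q U, t M ≤ 1
    have h1 : ∀ M ∈ fam Q U, t M ≤ (if x ∉ uni M then t M else 0) +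
        ∑ A ∈ Q.filter (fun A => x ∈ A), if A ∈ M then t M else 0 := by
      intro M hM
      by_cases hxM : x ∈ uni M
      · obtain ⟨A, hA, hxA⟩ := mem_uni.1 hxM
        refine le_trans ?_ (le_add_of_nonneg_left zero_le)
        refine le_trans ?_ (Finset.single_le_sum (f := fun A => if A ∈ M then t M else 0)
          (fun _ _ => zero_le) (Finset.mem_filter.2 ⟨(mem_fam.1 hM).1 hA, hxA⟩))
        simp [hA]
      · simp [hxM]
    refine (Finset.sum_le_sum h1).trans ?_
    rw [Finset.sum_add_distrib, Finset.sum_comm]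
    simp_rw [← Finset.sum_filter]
    refine le_trans (add_le_add ?_ (Finset.sum_le_sum ?_)) (hw x)
    · calc ∑ M ∈ (fam Q U).filter (fun M => x ∉ uni M), t M
          ≤ ∑ M ∈ fam Q (U.erase x), q * ((∏ A ∈ M, w A) * q ^ ((U.erase x) \ uni M).card) := by
            refine sum_le_sum_inj _ _ _ _ (fun M => M) (fun _ _ _ _ h => h) ?_ ?_
            · intro M hM
              rw [Finset.mem_filter, mem_fam] at hM
              rw [mem_fam]
              refine ⟨hM.1.1, fun A hA y hy => Finset.mem_erase.2 ⟨?_, hM.1.2.1 A hA hy⟩, hM.1.2.2⟩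
              rintro rfl
              exact hM.2 (mem_uni.2 ⟨A, hA, hy⟩)
            · intro M hM
              rw [Finset.mem_filter] at hM
              have : U \ uni M = insert x ((U.erase x) \ uni M) := by
                ext y
                simp only [Finset.mem_sdiff, Finset.mem_insert, Finset.mem_erase]
                by_cases hyx : y = x
                · subst hyx; simp [hx, hM.2]
                · simp [hyx]
              simp only [t]
              rw [this, Finset.card_insert_of_notMem (by simp), pow_succ]
              apply le_of_eq; ring
        _ ≤ q := by
            rw [← Finset.mul_sum]
            exact mul_le_of_le_one_right zero_le (ih _ (Finset.erase_ssubset hx))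
    · intro A hA
      rw [Finset.mem_filter] at hA
      calc ∑ M ∈ (fam Q U).filter (fun M => A ∈ M), t M
          ≤ ∑ M ∈ fam Q (U \ A), w A * ((∏ A ∈ M, w A) * q ^ ((U \ A) \ uni M).card) := by
            refine sum_le_sum_inj _ _ _ _ (fun M => M.erase A) ?_ ?_ ?_
            · intro M hM M' hM' h
              simp only [Finset.coe_filter, Set.mem_setOf_eq] at hM hM'
              simp only at h
              rw [← Finset.insert_erase hM.2, h, Finset.insert_erase hM'.2]
            · intro M hM
              rw [Finset.mem_filter, mem_fam] at hM
              rw [mem_fam]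
              refine ⟨(Finset.erase_subset _ _).trans hM.1.1, fun B hB y hy => ?_,
                fun B hB C hC => hM.1.2.2 B (Finset.mem_of_mem_erase hB) C
                  (Finset.mem_of_mem_erase hC)⟩
              have hB' := Finset.mem_erase.1 hB
              rw [Finset.mem_sdiff]
              exact ⟨hM.1.2.1 B hB'.2 hy,
                Finset.disjoint_left.1 (hM.1.2.2 B hB'.2 A hM.2 hB'.1) hy⟩
            · intro M hM
              rw [Finset.mem_filter] at hM
              have : U \ uni M = (U \ A) \ uni (M.erase A) := by
                ext y
                simp only [Finset.mem_sdiff, mem_uni, Finset.mem_erase, not_exists, not_and]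
                constructor
                · rintro ⟨a, b⟩
                  exact ⟨⟨a, b A hM.2⟩, fun B hB => b B hB.2⟩
                · rintro ⟨⟨a, b⟩, c⟩
                  refine ⟨a, fun B hB => ?_⟩
                  by_cases h : B = A
                  · rw [h]; exact b
                  · exact c B ⟨h, hB⟩
              simp only [t]
              rw [this, ← Finset.mul_prod_erase M w hM.2, mul_assoc]
        _ ≤ w A := by
            rw [← Finset.mul_sum]
            refine mul_le_of_le_one_right zero_le (ih _ ?_)
            refine (Finset.ssubset_iff_of_subset Finset.sdiff_subset).2 ⟨x, hx, ?_⟩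
            simp [hA.2]

end XiPart

noncomputable section SpikePart
open scoped Classical

lemma card_incE_singleton (v : Site) : (incE {v}).card ≤ 4 := by
  unfold incE
  refine (Finset.card_union_le _ _).trans ?_
  have := Finset.card_union_le ((({v} : Finset Site).image fun v => ((v - (1, 0), true) : LEdge)))
    (({v} : Finset Site).image fun v => ((v - (0, 1), false) : LEdge))
  simp only [Finset.image_singleton, Finset.card_singleton] at this
  simp only [Finset.image_singleton, Finset.card_product, Finset.card_singleton,
    Finset.card_univ, Fintype.card_bool]
  omega

lemma En_update (V : Finset Site) (ψ : Site → ℤ) (v : Site) {k : ℤ} (hk : 0 ≤ k) (hψ : ψ v = k) :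
    En V (Function.update ψ v 0) ≤ En V ψ + 4 * k := by
  have h1 : ∀ e ∈ incE V, |Function.update ψ v 0 e.1 - Function.update ψ v 0 (eHead e)| ≤
      |ψ e.1 - ψ (eHead e)| + (if e ∈ incE {v} then k else 0) := by
    intro e _
    by_cases a : e.1 = v <;> by_cases b : eHead e = v
    · have : e ∈ incE {v} := by rw [mem_incE]; simp [a]
      simp [a, b, this, hk]
    · have : e ∈ incE {v} := by rw [mem_incE]; simp [a]
      simp only [a, this, if_true, Function.update_self, Function.update_of_ne b, hψ]
      rw [← abs_of_nonneg hk]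
      have := abs_sub_abs_le_abs_sub (ψ (eHead e)) k
      have h3 := abs_sub_comm |k| (ψ (eHead e))
      rw [abs_of_nonneg hk] at *
      rw [zero_sub, abs_neg]
      rw [h3]; linarith
    · have : e ∈ incE {v} := by rw [mem_incE]; simp [b]
      simp only [b, this, if_true, Function.update_self, Function.update_of_ne a, hψ]
      rw [sub_zero]
      have := abs_sub_abs_le_abs_sub (ψ e.1) k
      rw [abs_of_nonneg hk] at this
      linarith
    · have : e ∉ incE {v} := by rw [mem_incE]; simp [a, b]
      simp [Function.update_of_ne a, Function.update_of_ne b, this]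
  unfold En
  refine (Finset.sum_le_sum h1).trans ?_
  rw [Finset.sum_add_distrib]
  gcongr
  rw [← Finset.sum_filter, Finset.sum_const, nsmul_eq_mul]
  have h2 : ((incE V).filter (fun e => e ∈ incE {v})).card ≤ 4 := by
    refine le_trans (Finset.card_le_card ?_) (card_incE_singleton v)
    intro e he
    exact (Finset.mem_filter.1 he).2
  have h3 : (((incE V).filter (fun e => e ∈ incE {v})).card : ℤ) ≤ 4 := by exact_mod_cast h2
  nlinarith

lemma Fl_update (V : Finset Site) (ψ : Site → ℤ) (v : Site) (hψ : 0 ≤ ψ v) :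
    Fl V (Function.update ψ v 0) ≤ Fl V ψ := by
  unfold Fl
  apply Finset.sum_le_sum
  intro x _
  by_cases h : x = v
  · subst h; simpa using hψ
  · simp [h]

lemma wt_mono {β lam : ℝ} {V : Finset Site} {ψ φ : Site → ℤ} {c : ℝ}
    (h : β * En V φ + lam * Fl V φ ≤ β * En V ψ + lam * Fl V ψ + c) :
    wt β lam V ψ ≤ ex c * wt β lam V φ := by
  rw [wt_eq, wt_eq, ← ex_add]
  apply ex_mono
  linarith

lemma geom_bound {β : ℝ} (hβ : 100 ≤ β) (H : ℕ) :
    ∑ k ∈ Finset.range H, Real.exp (4 * β * ((k : ℝ) + 1)) ≤ 2 * Real.exp (4 * β * H) := by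
  induction H with
  | zero => simp
  | succ n ih =>
    rw [Finset.sum_range_succ]
    have h1 : Real.exp (4 * β * ((n : ℝ) + 1)) = Real.exp (4 * β * n) * Real.exp (4 * β) := by
      rw [← Real.exp_add]; congr 1; ring
    have h2 : (2 : ℝ) ≤ Real.exp (4 * β) := by
      have := Real.add_one_le_exp (4 * β)
      linarith
    push_cast
    rw [h1]
    have := Real.exp_pos (4 * β * n)
    nlinarith

/-- The spike rate. -/
def pp (β : ℝ) (H : ℕ) : ℝ := Real.exp (-4 * β * H) / 4

lemma pp_pos (β : ℝ) (H : ℕ) : 0 < pp β H := by unfold pp; positivity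

lemma pp_le {β : ℝ} (hβ : 100 ≤ β) (H : ℕ) : pp β H ≤ 1 / 4 := by
  unfold pp
  have : Real.exp (-4 * β * H) ≤ 1 := by
    apply Real.exp_le_one_iff.2
    have : (0 : ℝ) ≤ H := Nat.cast_nonneg _
    nlinarith
  linarith

lemma spike_one {β lam : ℝ} (hβ : 100 ≤ β) (hl : 0 ≤ lam) {V : Finset Site} {v : Site} (H : ℕ)
    (K : Set (Site → ℤ)) (hK : ∀ ψ ∈ K, 0 ≤ ψ v ∧ ψ v ≤ H ∧ Function.update ψ v 0 ∈ K) :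
    ZZ β lam V (K ∩ {ψ | 1 ≤ ψ v}) ≤ ex (-pp β H) * ZZ β lam V K := by
  set a := ZZ β lam V (K ∩ {ψ | 1 ≤ ψ v}) with ha
  set b := ZZ β lam V (K ∩ {ψ | ψ v = 0}) with hb
  have hab : a + b ≤ ZZ β lam V K := by
    rw [ha, hb, ← ZZ_union_disj]
    · exact ZZ_mono (by rintro ψ (h | h) <;> exact h.1)
    · rw [Set.disjoint_left]
      rintro ψ ⟨_, h1⟩ ⟨_, h2⟩
      simp only [Set.mem_setOf_eq] at h1 h2
      omega
  have h1 : a ≤ ∑ k ∈ Finset.range H, ZZ β lam V (K ∩ {ψ | ψ v = (k : ℤ) + 1}) := by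
    apply ZZ_le_sum
    rintro ψ ⟨h1, h2⟩
    have := hK ψ h1
    simp only [Set.mem_setOf_eq] at h2
    refine ⟨(ψ v - 1).toNat, ?_, h1, ?_⟩
    · rw [Finset.mem_range]; omega
    · simp only [Set.mem_setOf_eq]; omega
  have h2 : ∀ k ∈ Finset.range H, ZZ β lam V (K ∩ {ψ | ψ v = (k : ℤ) + 1}) ≤
      ex (4 * β * ((k : ℝ) + 1)) * b := by
    intro k _
    apply ZZ_le_of_map _ (fun ψ => Function.update ψ v 0)
    · rintro ψ ⟨_, h1⟩ φ ⟨_, h2⟩ h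
      simp only [Set.mem_setOf_eq] at h1 h2
      funext x
      by_cases hx : x = v
      · rw [hx, h1, h2]
      · have := congrFun h x
        simpa [hx] using this
    · rintro ψ ⟨h1, _⟩
      exact ⟨(hK ψ h1).2.2, by simp⟩
    · rintro ψ ⟨h1, h2⟩
      simp only [Set.mem_setOf_eq] at h2
      apply wt_mono
      have e1 := En_update V ψ v (k := (k : ℤ) + 1) (by positivity) h2
      have e2 := Fl_update V ψ v (hK ψ h1).1
      have e1' : (En V (Function.update ψ v 0) : ℝ) ≤ En V ψ + 4 * ((k : ℝ) + 1) := by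
        exact_mod_cast e1
      have e2' : (Fl V (Function.update ψ v 0) : ℝ) ≤ Fl V ψ := by exact_mod_cast e2
      nlinarith
  set s : ENNReal := ENNReal.ofReal (2 * Real.exp (4 * β * H)) with hs
  have h3 : a ≤ s * b := by
    refine h1.trans ((Finset.sum_le_sum h2).trans ?_)
    rw [← Finset.sum_mul]
    gcongr
    unfold ex
    rw [← ENNReal.ofReal_sum_of_nonneg (fun _ _ => (Real.exp_pos _).le)]
    exact ENNReal.ofReal_le_ofReal (geom_bound hβ H)
  have h4 : s ≤ ex (-pp β H) * (1 + s) := by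
    rw [hs, ex, ← ENNReal.ofReal_one, ← ENNReal.ofReal_add (by norm_num) (by positivity),
      ← ENNReal.ofReal_mul (Real.exp_pos _).le]
    apply ENNReal.ofReal_le_ofReal
    have e1 := Real.add_one_le_exp (-pp β H)
    have e2 : pp β H * Real.exp (4 * β * H) = 1 / 4 := by
      unfold pp
      rw [div_mul_eq_mul_div, ← Real.exp_add]
      ring_nf
      simp
    have e3 := pp_le hβ H
    have e4 := Real.exp_pos (4 * β * H)
    nlinarith
  have h5 : (1 + s) * a ≤ (1 + s) * (ex (-pp β H) * ZZ β lam V K) := by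
    calc (1 + s) * a = a + s * a := by ring
      _ ≤ s * b + s * a := by gcongr
      _ = s * (a + b) := by ring
      _ ≤ (ex (-pp β H) * (1 + s)) * ZZ β lam V K := by gcongr
      _ = _ := by ring
  refine (ENNReal.mul_le_mul_iff_right ?_ ?_).1 h5
  · simp
  · exact ENNReal.add_ne_top.2 ⟨ENNReal.one_ne_top, by rw [hs]; exact ENNReal.ofReal_ne_top⟩

lemma spike {β lam : ℝ} (hβ : 100 ≤ β) (hl : 0 ≤ lam) {V : Finset Site} (H : ℕ)
    (K : Set (Site → ℤ)) (R : Finset Site)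
    (hK : ∀ ψ ∈ K, ∀ v ∈ R, 0 ≤ ψ v ∧ ψ v ≤ H ∧ Function.update ψ v 0 ∈ K) :
    ZZ β lam V (K ∩ {ψ | ∀ v ∈ R, 1 ≤ ψ v}) ≤ ex (-pp β H * R.card) * ZZ β lam V K := by
  have key : ∀ D : Finset Site, D ⊆ R →
      ZZ β lam V (K ∩ {ψ | ∀ v ∈ D, 1 ≤ ψ v}) ≤ ex (-pp β H * D.card) * ZZ β lam V K := by
    intro D
    induction D using Finset.induction_on with
    | empty => intro _; simp [ex_zero]
    | insert v D hv ih =>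
      intro hD
      rw [Finset.insert_subset_iff] at hD
      have h1 := spike_one hβ hl (V := V) (v := v) H (K ∩ {ψ | ∀ v ∈ D, 1 ≤ ψ v}) (by
        rintro ψ ⟨h1, h2⟩
        refine ⟨(hK ψ h1 v hD.1).1, (hK ψ h1 v hD.1).2.1, (hK ψ h1 v hD.1).2.2, ?_⟩
        intro x hx
        have : x ≠ v := fun h => hv (h ▸ hx)
        simpa [this] using h2 x hx)
      have h2 : K ∩ {ψ | ∀ x ∈ insert v D, 1 ≤ ψ x} =
          (K ∩ {ψ | ∀ v ∈ D, 1 ≤ ψ v}) ∩ {ψ | 1 ≤ ψ v} := by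
        ext ψ
        simp only [Set.mem_inter_iff, Set.mem_setOf_eq, Finset.mem_insert, forall_eq_or_imp]
        tauto
      rw [h2, Finset.card_insert_of_notMem hv]
      refine h1.trans ?_
      calc _ ≤ ex (-pp β H) * (ex (-pp β H * D.card) * ZZ β lam V K) := by
            gcongr; exact ih hD.2
        _ = _ := by
            rw [← mul_assoc, ← ex_add]; congr 2; push_cast; ring
  exact key R (Finset.Subset.refl _)

lemma ZZ_fiber_le {β lam : ℝ} {V : Finset Site} {ι : Type*} (s : Finset ι) (K : Set (Site → ℤ))
    (f : (Site → ℤ) → ι) :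
    ∑ i ∈ s, ZZ β lam V (K ∩ {ψ | f ψ = i}) ≤ ZZ β lam V K := by
  unfold ZZ
  rw [← Summable.tsum_finsetSum (fun i _ => ENNReal.summable)]
  apply ENNReal.tsum_le_tsum
  intro ψ
  by_cases hψ : ψ ∈ K
  · have : ∀ i, (K ∩ {ψ | f ψ = i}).indicator (wt β lam V) ψ =
        if f ψ = i then wt β lam V ψ else 0 := by
      intro i
      by_cases h : f ψ = i <;> simp [Set.indicator, hψ, h]
    simp_rw [this, Set.indicator_of_mem hψ]
    rw [Finset.sum_ite_eq]
    split_ifs <;> simp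
  · simp [hψ]

/-- All contours inside `V`. -/
def QQ (V : Finset Site) : Finset (Finset Site) := V.powerset.filter ContC

lemma outer_powerset_fam {L V : Finset Site} (hV : Good V) (hL : L ⊆ V)
    {M : Finset (Finset Site)} (hM : M ⊆ outer L) : M ∈ fam (QQ V) V := by
  rw [mem_fam]
  refine ⟨fun A hA => ?_, fun A hA => outer_sub hV hL (hM hA),
    fun A hA B hB hne => outer_disj (hM hA) (hM hB) hne⟩
  simp only [QQ, Finset.mem_filter, Finset.mem_powerset]
  exact ⟨outer_sub hV hL (hM hA), outer_contC (hM hA)⟩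

lemma exp_neg_le {t : ℝ} (h0 : 0 ≤ t) (h1 : t ≤ 1) : Real.exp (-t) ≤ 1 - t / 2 := by
  rw [Real.exp_neg]
  have h2 := Real.add_one_le_exp t
  rw [inv_le_comm₀ (Real.exp_pos t) (by linarith)]
  refine le_trans ?_ h2
  rw [inv_le_comm₀ (by linarith) (by linarith)]
  rw [← one_div, div_le_iff₀ (by linarith)]
  nlinarith

end SpikePart

noncomputable section PartOne
open scoped Classical

/-- high level set -/
def lev (V : Finset Site) (k : ℤ) (ψ : Site → ℤ) : Finset Site := V.filter fun v => k ≤ ψ v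

/-- lowering on a set -/
def lower (U : Finset Site) (ψ : Site → ℤ) : Site → ℤ := fun x => if x ∈ U then ψ x - 1 else ψ x

lemma lower_inj (U : Finset Site) : Function.Injective (lower U) := by
  intro ψ φ h
  funext x
  have := congrFun h x
  unfold lower at this
  split_ifs at this <;> omega

lemma Fl_lower {U V : Finset Site} (hUV : U ⊆ V) (ψ : Site → ℤ) :
    Fl V ψ = Fl V (lower U ψ) + U.card := by
  have : ∀ v ∈ V, ψ v = lower U ψ v + if v ∈ U then 1 else 0 := by
    intro v _
    unfold lower
    split_ifs <;> omega
  rw [Fl, Finset.sum_congr rfl this, Finset.sum_add_distrib, Fl, ← Finset.sum_filter,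
    Finset.sum_const, nsmul_eq_mul, mul_one]
  congr 3
  ext x; simp; exact fun h => hUV h

lemma uni_sub {V L : Finset Site} (hV : Good V) (hL : L ⊆ V) {M : Finset (Finset Site)}
    (hM : M ⊆ outer L) : uni M ⊆ V := by
  intro x hx
  obtain ⟨A, hA, hxA⟩ := mem_uni.1 hx
  exact outer_sub hV hL (hM hA) hxA

lemma uni_orient {L : Finset Site} {M : Finset (Finset Site)}
    (hM : M ⊆ outer L) {e : LEdge} (he : e ∈ bdE (uni M)) :
    (e.1 ∈ uni M ↔ e.1 ∈ L) ∧ (eHead e ∈ uni M ↔ eHead e ∈ L) := by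
  have he' := he
  rw [mem_bdE_uni hM] at he
  obtain ⟨A, hA, heA⟩ := he
  have h1 := outer_orient (hM hA) heA
  rw [mem_bdE] at he' heA
  have h2 : e.1 ∈ A → e.1 ∈ uni M := fun h => mem_uni.2 ⟨A, hA, h⟩
  have h3 : eHead e ∈ A → eHead e ∈ uni M := fun h => mem_uni.2 ⟨A, hA, h⟩
  tauto

lemma lower_bound {β lam : ℝ} {V : Finset Site} (hV : Good V) (H : ℕ) {L0 : Finset Site}
    {M : Finset (Finset Site)} (hL0 : L0 ⊆ V) (hM0 : M ⊆ outer L0) :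
    ZZ β lam V {ψ | ψ ∈ Mi V H ∧ M ⊆ outer (lev V (H + 1) ψ) ∧
        ∀ x ∈ uni (outer (lev V (H + 1) ψ)), 1 ≤ ψ x} ≤
      ex (-(β * (bdE (uni M)).card + lam * (uni M).card)) * ZZ β lam V (Mi V H) := by
  have hU : uni M ⊆ V := uni_sub hV hL0 hM0
  apply ZZ_le_of_map _ (lower (uni M)) ((lower_inj _).injOn)
  · rintro ψ ⟨h1, h2, h3⟩
    rw [mem_Mi] at h1 ⊢
    refine ⟨fun x hx => ?_, fun x hx => ?_, fun x hx => ?_⟩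
    · have : x ∉ uni M := fun h => hx (hU h)
      simp [lower, this, h1.1 x hx]
    · by_cases h : x ∈ uni M
      · obtain ⟨A, hA, hxA⟩ := mem_uni.1 h
        have := h3 x (mem_uni.2 ⟨A, h2 hA, hxA⟩)
        simp only [lower, h, if_true]; omega
      · simp only [lower, h, if_false]; exact h1.2.1 x hx
    · have := h1.2.2 x hx
      unfold lower
      split_ifs <;> omega
  · rintro ψ ⟨h1, h2, h3⟩
    rw [mem_Mi] at h1
    apply wt_mono
    have hE : En V ψ = En V (lower (uni M) ψ) + (bdE (uni M)).card := by
      apply En_shift hU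
      intro e _
      have hout : ∀ x, x ∉ lev V (H + 1) ψ → ψ x ≤ H := by
        intro x hx
        by_cases hxV : x ∈ V
        · simp only [lev, Finset.mem_filter, not_and, not_le] at hx
          have := hx hxV
          omega
        · exact (h1.1 x hxV).le
      have hin : ∀ x, x ∈ lev V (H + 1) ψ → (H : ℤ) + 1 ≤ ψ x := by
        intro x hx
        simp only [lev, Finset.mem_filter] at hx
        exact hx.2
      by_cases he : e ∈ bdE (uni M)
      · have ho := uni_orient h2 he
        have he' := mem_bdE.1 he
        by_cases a : e.1 ∈ uni M <;> by_cases b : eHead e ∈ uni M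
        · tauto
        · have := hin _ (ho.1.1 a)
          have := hout _ (fun h => b (ho.2.2 h))
          simp only [he, lower, a, b, if_true, if_false]
          rw [abs_of_nonneg (by omega), abs_of_nonneg (by omega)]; ring
        · have := hin _ (ho.2.1 b)
          have := hout _ (fun h => a (ho.1.2 h))
          simp only [he, lower, a, b, if_true, if_false]
          rw [abs_of_nonpos (by omega), abs_of_nonpos (by omega)]; ring
        · tauto
      · have he' := he
        rw [mem_bdE] at he'
        push Not at he'
        by_cases a : e.1 ∈ uni M <;> by_cases b : eHead e ∈ uni M <;>
          simp [lower, a, b, he] <;> tauto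
    rw [hE, Fl_lower hU ψ]
    push_cast
    linarith

lemma up_shift {β lam : ℝ} {V : Finset Site} (h : ℕ) :
    ZZ β lam V (Mi V h) ≤ ex (lam * V.card) *
      ZZ β lam V {ψ | ψ ∈ Mi V ((h + 1 : ℕ) : ℤ) ∧ ∀ x ∈ V, 1 ≤ ψ x} := by
  apply ZZ_le_of_map _ (fun ψ x => ψ x + 1)
  · intro ψ _ φ _ hh
    funext x
    have := congrFun hh x
    simpa using this
  · intro ψ hψ
    rw [mem_Mi] at hψ
    simp only [Set.mem_setOf_eq, mem_Mi]
    push_cast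
    refine ⟨⟨fun x hx => by rw [hψ.1 x hx], fun x hx => by have := hψ.2.1 x hx; omega,
      fun x hx => by have := hψ.2.2 x hx; omega⟩, fun x hx => by have := hψ.2.1 x hx; omega⟩
  · intro ψ _
    apply wt_mono
    have h1 : En V (fun x => ψ x + 1) = En V ψ := by
      unfold En
      apply Finset.sum_congr rfl
      intro e _
      congr 1; ring
    have h2 : Fl V (fun x => ψ x + 1) = Fl V ψ + V.card := by
      unfold Fl
      rw [Finset.sum_add_distrib]; simp
    rw [h1, h2]
    push_cast
    linarith

/-- weights -/
def w0 (p : ℝ) (A : Finset Site) : ENNReal := ENNReal.ofReal (Real.exp (p * A.card) - 1)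

lemma one_add_w0 {p : ℝ} (hp : 0 ≤ p) (A : Finset Site) : 1 + w0 p A = ex (p * A.card) := by
  unfold w0 ex
  have : (0 : ℝ) ≤ Real.exp (p * A.card) - 1 := by
    have := Real.add_one_le_exp (p * A.card)
    have : 0 ≤ p * A.card := by positivity
    linarith
  rw [← ENNReal.ofReal_one, ← ENNReal.ofReal_add zero_le_one this]
  congr 1; ring

lemma ex_expand {V L : Finset Site} (hV : Good V) (hL : L ⊆ V) {p : ℝ} (hp : 0 ≤ p) :
    ex (-p * (V \ uni (outer L)).card) = ex (-p * V.card) *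
      ∑ M ∈ (outer L).powerset, ∏ A ∈ M, w0 p A := by
  rw [← Finset.prod_one_add]
  rw [Finset.prod_congr rfl (fun A _ => one_add_w0 hp A), ← ex_sum, ← ex_add]
  congr 1
  have h1 := uni_sub hV hL (Finset.Subset.refl (outer L))
  rw [Finset.cast_card_sdiff h1, ← Finset.mul_sum, card_uni (Finset.Subset.refl (outer L))]
  push_cast
  ring

lemma coef1 {V L : Finset Site} (hV : Good V) (hL : L ⊆ V) {β lam p : ℝ} (hp : 0 ≤ p)
    {M : Finset (Finset Site)} (hM : M ⊆ outer L) :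
    ex (lam * V.card) * (ex (-p * V.card) * ((∏ A ∈ M, w0 p A) *
      ex (-(β * (bdE (uni M)).card + lam * (uni M).card)))) =
    (∏ A ∈ M, w0 p A * ex (-p * A.card - β * (bdE A).card)) *
      ex (-(p - lam)) ^ (V \ uni M).card := by
  rw [Finset.prod_mul_distrib, ← ex_sum, ← ex_nat_mul]
  have h : ∀ a b c d : ENNReal, a * (b * (c * d)) = c * (a * b * d) := by intros; ring
  rw [h, ← ex_add, ← ex_add, mul_assoc, ← ex_add]
  congr 2
  have h1 := uni_sub hV hL hM
  rw [Finset.cast_card_sdiff h1, Finset.sum_sub_distrib, ← Finset.mul_sum, ← Finset.mul_sum,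
    card_uni hM, card_bdE_uni hM]
  push_cast
  ring

lemma partOne_Xi {β lam : ℝ} (hβ : 100 ≤ β) (hl : 0 < lam) (h : ℕ)
    (hlam : lam ≤ Real.exp (-4 * β * (h + 1 : ℕ) - β)) (V : Finset Site) :
    ∑ M ∈ fam (QQ V) V, (∏ A ∈ M, w0 (pp β (h + 1)) A *
      ex (-pp β (h + 1) * A.card - β * (bdE A).card)) *
      ex (-(pp β (h + 1) - lam)) ^ (V \ uni M).card ≤ 1 := by
  set p := pp β (h + 1) with hp
  have hp0 : 0 < p := pp_pos _ _
  have hp1 : p ≤ 1 / 4 := pp_le hβ _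
  apply Xi_le_one
  · intro A hA
    simp only [QQ, Finset.mem_filter] at hA
    exact hA.2.1
  · intro x
    have h2 := exp_two_beta hβ
    have hsmall : Real.exp (-2 * β) ≤ 1 / 8 := by
      rw [show -2 * β = -(2 * β) by ring, Real.exp_neg, inv_le_comm₀ (Real.exp_pos _) (by norm_num)]
      refine le_trans ?_ h2
      norm_num
    have hlp : lam ≤ p / 2 := by
      refine hlam.trans ?_
      rw [hp, pp, Real.exp_sub]
      have : (8 : ℝ) ≤ Real.exp β := by
        have := Real.add_one_le_exp β
        linarith
      rw [div_le_iff₀ (Real.exp_pos _)]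
      have := Real.exp_pos (-4 * β * (h + 1 : ℕ))
      nlinarith
    have hterm : ∀ A : Finset Site, w0 p A * ex (-p * A.card - β * (bdE A).card) ≤
        ENNReal.ofReal (p * (A.card * Real.exp (-β * (bdE A).card))) := by
      intro A
      unfold w0 ex
      have hnn : (0 : ℝ) ≤ Real.exp (p * A.card) - 1 := by
        have := Real.add_one_le_exp (p * A.card)
        have : 0 ≤ p * A.card := by positivity
        linarith
      rw [← ENNReal.ofReal_mul hnn]
      apply ENNReal.ofReal_le_ofReal
      have e1 : Real.exp (-p * A.card - β * (bdE A).card) =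
          Real.exp (-(p * A.card)) * Real.exp (-β * (bdE A).card) := by
        rw [← Real.exp_add]; congr 1; ring
      rw [e1, ← mul_assoc, ← mul_assoc]
      apply mul_le_mul_of_nonneg_right _ (Real.exp_pos _).le
      rw [sub_mul, ← Real.exp_add]
      have := Real.add_one_le_exp (-(p * A.card))
      simp
      linarith
    calc _ ≤ ex (-(p - lam)) + ∑ A ∈ (QQ V).filter (fun A => x ∈ A),
          ENNReal.ofReal (p * (A.card * Real.exp (-β * (bdE A).card))) := by
            gcongr with A _
            exact hterm A
      _ = ex (-(p - lam)) + ENNReal.ofReal (p * ∑ A ∈ (QQ V).filter (fun A => x ∈ A),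
          (A.card * Real.exp (-β * (bdE A).card))) := by
            rw [Finset.mul_sum, ENNReal.ofReal_sum_of_nonneg]
            intro A _
            positivity
      _ ≤ ENNReal.ofReal (1 - (p - lam) / 2) + ENNReal.ofReal (p * (Real.exp (-2 * β) / 8)) := by
            gcongr
            · exact ENNReal.ofReal_le_ofReal (exp_neg_le (by linarith) (by linarith))
            · apply count_four hβ x
              intro A hA
              simp only [QQ, Finset.mem_filter] at hA
              exact ⟨hA.1.2, hA.2⟩
      _ ≤ 1 := by
            rw [← ENNReal.ofReal_add (by linarith) (by positivity), ← ENNReal.ofReal_one]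
            apply ENNReal.ofReal_le_ofReal
            nlinarith

theorem partOne {β lam : ℝ} (hβ : 100 ≤ β) (hl : 0 < lam) (h : ℕ)
    (hlam : lam ≤ Real.exp (-4 * β * (h + 1 : ℕ) - β)) {V : Finset Site} (hV : Good V) :
    ZZ β lam V (Mi V h) ≤ ZZ β lam V (Mi V ((h + 1 : ℕ) : ℤ)) := by
  set H : ℕ := h + 1 with hH
  set p := pp β H with hp
  have hp0 : 0 < p := pp_pos _ _
  let KL : Finset Site → Set (Site → ℤ) := fun L =>
    {ψ | ψ ∈ Mi V H ∧ lev V (H + 1) ψ = L ∧ ∀ x ∈ uni (outer L), 1 ≤ ψ x}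
  have hspike : ∀ L ∈ V.powerset, ZZ β lam V
      (KL L ∩ {ψ | ∀ v ∈ V \ uni (outer L), 1 ≤ ψ v}) ≤
      ∑ M ∈ (outer L).powerset, ex (-p * V.card) * (∏ A ∈ M, w0 p A) * ZZ β lam V (KL L) := by
    intro L hL
    rw [Finset.mem_powerset] at hL
    refine (spike hβ hl.le H (KL L) (V \ uni (outer L)) ?_).trans (le_of_eq ?_)
    · rintro ψ ⟨h1, h2, h3⟩ v hv
      rw [Finset.mem_sdiff] at hv
      have hvL : v ∉ lev V (H + 1) ψ := by
        rw [h2]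
        intro hv'
        obtain ⟨A, hA, hvA⟩ := outer_cover hv'
        exact hv.2 (mem_uni.2 ⟨A, hA, hvA⟩)
      have hvH : ψ v ≤ H := by
        simp only [lev, Finset.mem_filter, not_and, not_le] at hvL
        have := hvL hv.1
        omega
      have h1' := mem_Mi.1 h1
      refine ⟨h1'.2.1 v hv.1, hvH, ?_, ?_, ?_⟩
      · rw [mem_Mi]
        refine ⟨fun x hx => ?_, fun x hx => ?_, fun x hx => ?_⟩
        · have : x ≠ v := by rintro rfl; exact hx hv.1
          simp [this, h1'.1 x hx]
        · by_cases hxv : x = v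
          · simp [hxv]
          · simp [hxv, h1'.2.1 x hx]
        · by_cases hxv : x = v
          · simp [hxv]
          · simp [hxv, h1'.2.2 x hx]
      · rw [← h2]
        ext x
        simp only [lev, Finset.mem_filter]
        by_cases hxv : x = v
        · subst hxv
          simp only [Function.update_self]
          constructor <;> rintro ⟨_, _⟩ <;> exfalso <;> omega
        · simp [hxv]
      · intro x hx
        have : x ≠ v := by rintro rfl; exact hv.2 hx
        simp [this, h3 x hx]
    · rw [ex_expand hV hL hp0.le, Finset.mul_sum, Finset.sum_mul]
  calc ZZ β lam V (Mi V h) ≤ _ := up_shift h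
    _ ≤ ex (lam * V.card) * ∑ L ∈ V.powerset, ZZ β lam V
          (KL L ∩ {ψ | ∀ v ∈ V \ uni (outer L), 1 ≤ ψ v}) := by
        gcongr
        apply ZZ_le_sum
        rintro ψ ⟨h1, h2⟩
        have hsub : lev V (H + 1) ψ ⊆ V := Finset.filter_subset _ _
        refine ⟨lev V (H + 1) ψ, Finset.mem_powerset.2 hsub,
          ⟨h1, rfl, fun x hx => h2 x (uni_sub hV hsub (Finset.Subset.refl _) hx)⟩, ?_⟩
        intro v hv
        exact h2 v (Finset.mem_sdiff.1 hv).1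
    _ ≤ ex (lam * V.card) * ∑ L ∈ V.powerset, ∑ M ∈ (outer L).powerset,
          ex (-p * V.card) * (∏ A ∈ M, w0 p A) * ZZ β lam V (KL L) := by
        gcongr with L hL
        exact hspike L hL
    _ = ex (lam * V.card) * ∑ M ∈ fam (QQ V) V, ∑ L ∈ V.powerset.filter (fun L => M ⊆ outer L),
          ex (-p * V.card) * (∏ A ∈ M, w0 p A) * ZZ β lam V (KL L) := by
        congr 1
        apply Finset.sum_comm'
        intro L M
        simp only [Finset.mem_powerset, Finset.mem_filter]
        constructor
        · rintro ⟨a, b⟩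
          exact ⟨⟨a, b⟩, outer_powerset_fam hV a b⟩
        · rintro ⟨a, b⟩
          exact a
    _ ≤ ∑ M ∈ fam (QQ V) V, ((∏ A ∈ M, w0 p A * ex (-p * A.card - β * (bdE A).card)) *
      ex (-(p - lam)) ^ (V \ uni M).card) * ZZ β lam V (Mi V H) := by
        rw [Finset.mul_sum]
        apply Finset.sum_le_sum
        intro M _
        rw [← Finset.mul_sum]
        by_cases hex : ∃ L ⊆ V, M ⊆ outer L
        · obtain ⟨L0, hL0, hM0⟩ := hex
          rw [← coef1 hV hL0 hp0.le hM0]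
          have hinner : ∑ L ∈ V.powerset.filter (fun L => M ⊆ outer L), ZZ β lam V (KL L) ≤
              ex (-(β * (bdE (uni M)).card + lam * (uni M).card)) * ZZ β lam V (Mi V H) := by
            refine le_trans ?_ (lower_bound hV H hL0 hM0)
            refine le_trans ?_ (ZZ_fiber_le (V.powerset.filter (fun L => M ⊆ outer L)) _
              (lev V (H + 1)))
            apply Finset.sum_le_sum
            intro L hL
            apply ZZ_mono
            rintro ψ ⟨h1, h2, h3⟩
            rw [Finset.mem_filter] at hL
            exact ⟨⟨h1, by rw [h2]; exact hL.2, by rw [h2]; exact h3⟩, h2⟩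
          calc _ ≤ ex (lam * V.card) * (ex (-p * V.card) * (∏ A ∈ M, w0 p A) *
                (ex (-(β * (bdE (uni M)).card + lam * (uni M).card)) * ZZ β lam V (Mi V H))) := by
                gcongr
            _ = _ := by ring
        · have : V.powerset.filter (fun L => M ⊆ outer L) = ∅ := by
            rw [Finset.filter_eq_empty_iff]
            intro L hL hM
            exact hex ⟨L, Finset.mem_powerset.1 hL, hM⟩
          rw [this]
          simp
    _ ≤ ZZ β lam V (Mi V H) := by
        rw [← Finset.sum_mul]
        refine (mul_le_mul_left (partOne_Xi hβ hl h hlam V) _).trans ?_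
        rw [one_mul]

end PartOne

noncomputable section PartTwo
open scoped Classical

lemma innerBdry_left {B : Finset Site} {e : LEdge} (he : e ∈ bdE B) (h : e.1 ∈ B) :
    e.1 ∈ innerBdry B := mem_innerBdry.2 ⟨h, e, he, Or.inl rfl⟩

lemma innerBdry_right {B : Finset Site} {e : LEdge} (he : e ∈ bdE B) (h : eHead e ∈ B) :
    eHead e ∈ innerBdry B := mem_innerBdry.2 ⟨h, e, he, Or.inr rfl⟩

/-- outside endpoints are at height at least `c` -/
def outGe (B : Finset Site) (c : ℤ) (g : Site → ℤ) : Prop :=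
  ∀ e ∈ bdE B, (e.1 ∉ B → c ≤ g e.1) ∧ (eHead e ∉ B → c ≤ g (eHead e))

lemma cross_of {B : Finset Site} {c' c : ℤ} {ψ : Site → ℤ}
    (hin : ∀ x ∈ innerBdry B, ψ x ≤ c') (hout : outGe B c ψ) : crossOK B c' c ψ := by
  intro e he
  have h := mem_bdE.1 he
  constructor
  · intro h1
    exact ⟨hin _ (innerBdry_left he h1), (hout e he).2 (by tauto)⟩
  · intro h1
    have h2 : eHead e ∈ B := by tauto
    exact ⟨hin _ (innerBdry_right he h2), (hout e he).1 h1⟩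

lemma outGe_gOut {B : Finset Site} {c k : ℤ} {ψ : Site → ℤ} :
    outGe B c (gOut B k ψ) ↔ outGe B c ψ := by
  unfold outGe
  constructor
  · intro h e he
    constructor
    · intro h1
      have := (h e he).1 h1
      simpa [gOut, h1] using this
    · intro h1
      have := (h e he).2 h1
      simpa [gOut, h1] using this
  · intro h e he
    constructor
    · intro h1
      have := (h e he).1 h1
      simpa [gOut, h1] using this
    · intro h1
      have := (h e he).2 h1
      simpa [gOut, h1] using this

/-- outside configurations -/
def Kout (V B : Finset Site) (c : ℤ) : Set (Site → ℤ) :=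
  {g | g ∈ Mi V c ∧ (∀ x ∈ B, g x = c) ∧ outGe B c g}

lemma glueM {β lam : ℝ} {B V : Finset Site} (hBV : B ⊆ V) {c' c : ℤ} (hc : c' ≤ c)
    (Kin : Set (Site → ℤ)) (hK : Kin ⊆ Mi B c') :
    ZZ β lam V {ψ | gIn B c' ψ ∈ Kin ∧ gOut B c ψ ∈ Kout V B c} =
      ex (lam * c * B.card - β * (c - c') * (bdE B).card) *
        (ZZ β lam B Kin * ZZ β lam V (Kout V B c)) := by
  apply ZZ_glue hBV hc
  · intro f hf x hx
    exact (mem_Mi.1 (hK hf)).1 x hx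
  · intro g hg x hx
    exact hg.2.1 x hx
  · intro ψ h1 h2
    apply cross_of
    · intro x hx
      have h3 := (mem_Mi.1 (hK h1)).2.2 x hx
      have : x ∈ B := (mem_innerBdry.1 hx).1
      simpa [gIn, this] using h3
    · exact outGe_gOut.1 h2.2.2

lemma innerBdry_mono {B V : Finset Site} (hBV : B ⊆ V) {x : Site} (hx : x ∈ innerBdry V)
    (hxB : x ∈ B) : x ∈ innerBdry B := by
  simp only [innerBdry, Finset.mem_filter] at hx ⊢
  obtain ⟨_, d, hd, h⟩ := hx
  exact ⟨hxB, d, hd, fun h' => h (hBV h')⟩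

lemma glue_back {B V : Finset Site} (hBV : B ⊆ V) {c : ℤ} :
    {ψ | gIn B c ψ ∈ Mi B c ∧ gOut B c ψ ∈ Kout V B c} ⊆ Mi V c := by
  rintro ψ ⟨h1, h2, _, _⟩
  rw [mem_Mi] at h1 h2 ⊢
  refine ⟨fun x hx => ?_, fun x hx => ?_, fun x hx => ?_⟩
  · have hxB : x ∉ B := fun h => hx (hBV h)
    have := h2.1 x hx
    simpa [gOut, hxB] using this
  · by_cases hxB : x ∈ B
    · have := h1.2.1 x hxB
      simpa [gIn, hxB] using this
    · have := h2.2.1 x hx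
      simpa [gOut, hxB] using this
  · by_cases hxB : x ∈ B
    · have := h1.2.2 x (innerBdry_mono hBV hx hxB)
      simpa [gIn, hxB] using this
    · have := h2.2.2 x hx
      simpa [gOut, hxB] using this

lemma exp_half_le_two {t : ℝ} (ht : t ≤ 1 / 2) : Real.exp t ≤ 2 := by
  rw [← Real.le_log_iff_exp_le (by norm_num)]
  have := Real.log_two_gt_d9
  linarith

lemma single_bound {β lam : ℝ} (hβ : 100 ≤ β) (hl : 0 < lam) (h : ℕ)
    (hlam : lam ≤ Real.exp (-4 * β * (h + 1 : ℕ) - β)) (v : Site) :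
    ZZ β lam {v} (Mi {v} h ∩ {ψ | ψ v = 0}) ≤ ENNReal.ofReal (2 * Real.exp (-4 * β * h)) *
      ZZ β lam {v} (Mi {v} ((h + 1 : ℕ) : ℤ)) := by
  apply ZZ_le_of_map _ (fun _ _ => ((h + 1 : ℕ) : ℤ))
  · intro ψ hψ φ hφ _
    funext x
    by_cases hx : x = v
    · rw [hx]
      exact hψ.2.trans hφ.2.symm
    · rw [(mem_Mi.1 hψ.1).1 x (by simpa using hx), (mem_Mi.1 hφ.1).1 x (by simpa using hx)]
  · intro ψ _
    rw [mem_Mi]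
    exact ⟨fun _ _ => rfl, fun _ _ => by positivity, fun _ _ => le_rfl⟩
  · rintro ψ ⟨h1, h2⟩
    have h1 := mem_Mi.1 h1
    simp only [Set.mem_setOf_eq] at h2
    have hE : (4 * h : ℤ) ≤ En {v} ψ := by
      have hsub : bdE {v} ⊆ incE {v} := by
        intro e he
        rw [mem_bdE] at he
        rw [mem_incE]
        tauto
      have h4 : 4 ≤ (bdE {v}).card := four_le_bdE ⟨v, by simp⟩
      calc (4 * h : ℤ) ≤ (bdE {v}).card * h := by
            have : (4 : ℤ) ≤ (bdE {v}).card := by exact_mod_cast h4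
            gcongr
        _ = ∑ e ∈ bdE {v}, (h : ℤ) := by rw [Finset.sum_const, nsmul_eq_mul]
        _ ≤ ∑ e ∈ bdE {v}, |ψ e.1 - ψ (eHead e)| := by
            apply Finset.sum_le_sum
            intro e he
            rw [mem_bdE] at he
            by_cases a : e.1 ∈ ({v} : Finset Site)
            · have b : eHead e ∉ ({v} : Finset Site) := by tauto
              rw [h1.1 _ b, Finset.mem_singleton.1 a, h2]
              simp
            · have b : eHead e ∈ ({v} : Finset Site) := by tauto
              rw [h1.1 _ a, Finset.mem_singleton.1 b, h2]
              simp
        _ ≤ En {v} ψ := Finset.sum_le_sum_of_subset_of_nonneg hsub (fun _ _ _ => abs_nonneg _)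
    have hE2 : En {v} (fun _ => ((h + 1 : ℕ) : ℤ)) = 0 := by simp [En]
    have hF : Fl {v} ψ = 0 := by simp [Fl, h2]
    have hF2 : Fl {v} (fun _ => ((h + 1 : ℕ) : ℤ)) = (h + 1 : ℕ) := by simp [Fl]
    have hE' : (4 * h : ℝ) ≤ (En {v} ψ : ℝ) := by exact_mod_cast hE
    refine (wt_mono (φ := fun _ => ((h + 1 : ℕ) : ℤ)) (c := -4 * β * h + lam * (h + 1 : ℕ)) ?_).trans ?_
    · rw [hE2, hF, hF2]
      push_cast
      nlinarith
    · gcongr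
      apply ENNReal.ofReal_le_ofReal
      rw [Real.exp_add, mul_comm]
      gcongr
      apply exp_half_le_two
      set x : ℝ := ((h + 1 : ℕ) : ℝ) with hx
      have hx0 : 0 < x := by rw [hx]; positivity
      have e1 : Real.exp (-4 * β * x - β) * (4 * β * x) ≤ 1 := by
        have := Real.add_one_le_exp (4 * β * x + β)
        have e2 : Real.exp (-4 * β * x - β) * Real.exp (4 * β * x + β) = 1 := by
          rw [← Real.exp_add]; simp
        have := Real.exp_pos (-4 * β * x - β)
        nlinarith
      have e3 : lam * (4 * β * x) ≤ 1 := by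
        refine le_trans ?_ e1
        gcongr
      have : 0 < lam * x := by positivity
      nlinarith

/-- inner bound -/
def rB (β : ℝ) (h : ℕ) (B : Finset Site) : ℝ :=
  if 2 ≤ B.card then 4 * Real.exp (-4 * β * h) else 2 * Real.exp (-4 * β * h)

lemma rB_nonneg (β : ℝ) (h : ℕ) (B : Finset Site) : 0 ≤ rB β h B := by
  unfold rB
  split_ifs <;> positivity

lemma rB_sum {β : ℝ} (hβ : 100 ≤ β) (h : ℕ) (v : Site) (Q : Finset (Finset Site))
    (hQ : ∀ A ∈ Q, ContC A ∧ v ∈ A) :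
    ∑ A ∈ Q, rB β h A * Real.exp (-β * (bdE A).card) ≤ 4 * Real.exp (-4 * β * (h + 1 : ℕ)) := by
  rw [← Finset.sum_filter_add_sum_filter_not Q (fun A => 2 ≤ A.card)]
  have h1 : ∑ A ∈ Q.filter (fun A => 2 ≤ A.card), rB β h A * Real.exp (-β * (bdE A).card) ≤
      4 * Real.exp (-4 * β * h) * (Real.exp (-4 * β) / 2) := by
    have : ∀ A ∈ Q.filter (fun A => 2 ≤ A.card), rB β h A * Real.exp (-β * (bdE A).card) =
        4 * Real.exp (-4 * β * h) * Real.exp (-β * (bdE A).card) := by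
      intro A hA
      rw [Finset.mem_filter] at hA
      simp [rB, hA.2]
    rw [Finset.sum_congr rfl this, ← Finset.mul_sum]
    gcongr
    apply count_six hβ v
    intro A hA
    rw [Finset.mem_filter] at hA
    exact ⟨(hQ A hA.1).1, (hQ A hA.1).2, hA.2⟩
  have h2 : ∑ A ∈ Q.filter (fun A => ¬ 2 ≤ A.card), rB β h A * Real.exp (-β * (bdE A).card) ≤
      2 * Real.exp (-4 * β * h) * Real.exp (-4 * β) := by
    have hsub : Q.filter (fun A => ¬ 2 ≤ A.card) ⊆ {{v}} := by
      intro A hA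
      rw [Finset.mem_filter] at hA
      rw [Finset.mem_singleton]
      have hv := (hQ A hA.1).2
      have hc : A.card ≤ 1 := by omega
      ext x
      rw [Finset.mem_singleton]
      exact ⟨fun hx => Finset.card_le_one.1 hc x hx v hv, fun hx => by rw [hx]; exact hv⟩
    refine (Finset.sum_le_sum_of_subset_of_nonneg hsub (fun A _ _ =>
      mul_nonneg (rB_nonneg _ _ _) (Real.exp_pos _).le)).trans ?_
    rw [Finset.sum_singleton]
    have : rB β h {v} = 2 * Real.exp (-4 * β * h) := by simp [rB]
    rw [this]
    refine mul_le_mul_of_nonneg_left (Real.exp_le_exp.2 ?_) (by positivity)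
    have h4 : 4 ≤ (bdE {v}).card := four_le_bdE ⟨v, by simp⟩
    have : (4 : ℝ) ≤ (bdE {v}).card := by exact_mod_cast h4
    nlinarith
  have h3 : Real.exp (-4 * β * (h + 1 : ℕ)) = Real.exp (-4 * β * h) * Real.exp (-4 * β) := by
    rw [← Real.exp_add]
    congr 1
    push_cast
    ring
  rw [h3]
  linarith

theorem partTwo {β lam : ℝ} (hβ : 100 ≤ β) (hl : 0 < lam) (h : ℕ) :
    lam ≤ Real.exp (-4 * β * h - β) → ∀ {V : Finset Site}, Good V → ∀ v ∈ V,
    ZZ β lam V (Mi V h ∩ {ψ | ψ v = 0}) ≤ ENNReal.ofReal (4 * Real.exp (-4 * β * h)) *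
      ZZ β lam V (Mi V h) := by
  induction h with
  | zero =>
    intro _ V hV v hv
    refine (ZZ_mono Set.inter_subset_left).trans ?_
    refine le_mul_of_one_le_left zero_le ?_
    rw [← ENNReal.ofReal_one]
    apply ENNReal.ofReal_le_ofReal
    simp
  | succ h ih =>
    intro hlam V hV v hv
    have hlam' : lam ≤ Real.exp (-4 * β * h - β) := by
      refine hlam.trans (Real.exp_le_exp.2 ?_)
      push_cast
      nlinarith
    have hcc : (h : ℤ) ≤ ((h + 1 : ℕ) : ℤ) := by push_cast; omega
    set Q := (QQ V).filter (fun A => v ∈ A) with hQdef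
    have hQ : ∀ A ∈ Q, A ⊆ V ∧ ContC A ∧ v ∈ A := by
      intro A hA
      simp only [hQdef, QQ, Finset.mem_filter, Finset.mem_powerset] at hA
      exact ⟨hA.1.1, hA.1.2, hA.2⟩
    have hB : ∀ B ∈ Q, ZZ β lam V {ψ | gIn B h ψ ∈ Mi B h ∩ {ψ | ψ v = 0} ∧
        gOut B ((h + 1 : ℕ) : ℤ) ψ ∈ Kout V B ((h + 1 : ℕ) : ℤ)} ≤
        ENNReal.ofReal (rB β h B * Real.exp (-β * (bdE B).card)) *
          ZZ β lam V (Mi V ((h + 1 : ℕ) : ℤ)) := by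
      intro B hBQ
      obtain ⟨hBV, hBC, hvB⟩ := hQ B hBQ
      have hin : ZZ β lam B (Mi B h ∩ {ψ | ψ v = 0}) ≤ ENNReal.ofReal (rB β h B) *
          ZZ β lam B (Mi B ((h + 1 : ℕ) : ℤ)) := by
        by_cases hc : 2 ≤ B.card
        · simp only [rB, hc, if_true]
          refine (ih hlam' (good_of_contC hBC) v hvB).trans ?_
          gcongr
          exact partOne hβ hl h hlam (good_of_contC hBC)
        · have hBv : B = {v} := by
            have hc : B.card ≤ 1 := by omega
            ext x
            rw [Finset.mem_singleton]
            exact ⟨fun hx => Finset.card_le_one.1 hc x hx v hvB, fun hx => by rw [hx]; exact hvB⟩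
          subst hBv
          simp only [rB, hc, if_false]
          exact single_bound hβ hl h hlam v
      rw [glueM hBV hcc _ Set.inter_subset_left]
      have hback := ZZ_mono (β := β) (lam := lam) (V := V)
        (glue_back hBV (c := ((h + 1 : ℕ) : ℤ)))
      rw [glueM hBV le_rfl _ (Set.Subset.refl _)] at hback
      have hsplit : ex (lam * ((h + 1 : ℕ) : ℤ) * B.card -
          β * (((h + 1 : ℕ) : ℤ) - (h : ℤ)) * (bdE B).card) =
          ex (-β * (bdE B).card) * ex (lam * ((h + 1 : ℕ) : ℤ) * B.card -
          β * (((h + 1 : ℕ) : ℤ) - ((h + 1 : ℕ) : ℤ)) * (bdE B).card) := by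
        rw [← ex_add]
        congr 1
        push_cast
        ring
      rw [hsplit, ENNReal.ofReal_mul (rB_nonneg _ _ _)]
      change _ ≤ ENNReal.ofReal (rB β h B) * ex (-β * (bdE B).card) * _
      set κ := ex (lam * ((h + 1 : ℕ) : ℤ) * B.card -
          β * (((h + 1 : ℕ) : ℤ) - ((h + 1 : ℕ) : ℤ)) * (bdE B).card)
      calc _ ≤ ex (-β * (bdE B).card) * κ * ((ENNReal.ofReal (rB β h B) *
          ZZ β lam B (Mi B ((h + 1 : ℕ) : ℤ))) * ZZ β lam V (Kout V B ((h + 1 : ℕ) : ℤ))) := by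
            gcongr
        _ = ENNReal.ofReal (rB β h B) * ex (-β * (bdE B).card) * (κ *
          (ZZ β lam B (Mi B ((h + 1 : ℕ) : ℤ)) * ZZ β lam V (Kout V B ((h + 1 : ℕ) : ℤ)))) := by
            ring
        _ ≤ _ := by gcongr
    refine (ZZ_le_sum Q _ (fun B => {ψ | gIn B h ψ ∈ Mi B h ∩ {ψ | ψ v = 0} ∧
        gOut B ((h + 1 : ℕ) : ℤ) ψ ∈ Kout V B ((h + 1 : ℕ) : ℤ)}) ?_).trans ?_
    · rintro ψ ⟨h1, h2⟩
      rw [mem_Mi] at h1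
      simp only [Set.mem_setOf_eq] at h2
      set L := V.filter (fun x => ψ x ≤ h) with hL
      have hLV : L ⊆ V := Finset.filter_subset _ _
      have hvL : v ∈ L := by
        rw [hL, Finset.mem_filter, h2]
        exact ⟨hv, by positivity⟩
      obtain ⟨B, hBo, hvB⟩ := outer_cover hvL
      have hBV : B ⊆ V := outer_sub hV hLV hBo
      refine ⟨B, ?_, ?_⟩
      · simp only [hQdef, QQ, Finset.mem_filter, Finset.mem_powerset]
        exact ⟨⟨hBV, outer_contC hBo⟩, hvB⟩
      · have hnL : ∀ x, x ∉ L → ((h + 1 : ℕ) : ℤ) ≤ ψ x := by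
          intro x hx
          by_cases hxV : x ∈ V
          · simp only [hL, Finset.mem_filter, not_and, not_le] at hx
            have := hx hxV
            push_cast
            omega
          · exact (h1.1 x hxV).ge
        have hiL : ∀ x, x ∈ L → ψ x ≤ h := by
          intro x hx
          simp only [hL, Finset.mem_filter] at hx
          exact hx.2
        refine ⟨⟨?_, ?_⟩, ?_, ?_, ?_⟩
        · rw [mem_Mi]
          refine ⟨fun x hx => by simp [gIn, hx], fun x hx => ?_, fun x hx => ?_⟩
          · simp only [gIn, hx, if_true]
            exact h1.2.1 x (hBV hx)
          · rw [mem_innerBdry] at hx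
            obtain ⟨hxB, e, he, hxe⟩ := hx
            simp only [gIn, hxB, if_true]
            apply hiL
            have := outer_orient hBo he
            rcases hxe with rfl | rfl
            · exact this.1.1 hxB
            · exact this.2.1 hxB
        · simp [gIn, hvB, h2]
        · rw [mem_Mi]
          refine ⟨fun x hx => ?_, fun x hx => ?_, fun x hx => ?_⟩
          · have : x ∉ B := fun h => hx (hBV h)
            simp only [gOut, this, if_false]
            exact h1.1 x hx
          · unfold gOut
            split_ifs
            · positivity
            · exact h1.2.1 x hx
          · unfold gOut
            split_ifs
            · exact le_rfl
            · exact h1.2.2 x hx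
        · intro x hx
          simp [gOut, hx]
        · rw [outGe_gOut]
          intro e he
          have := outer_orient hBo he
          exact ⟨fun hx => hnL _ (fun h => hx (this.1.2 h)),
            fun hx => hnL _ (fun h => hx (this.2.2 h))⟩
    · calc _ ≤ ∑ B ∈ Q, ENNReal.ofReal (rB β h B * Real.exp (-β * (bdE B).card)) *
          ZZ β lam V (Mi V ((h + 1 : ℕ) : ℤ)) := Finset.sum_le_sum hB
        _ = ENNReal.ofReal (∑ B ∈ Q, rB β h B * Real.exp (-β * (bdE B).card)) *
          ZZ β lam V (Mi V ((h + 1 : ℕ) : ℤ)) := by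
            rw [← Finset.sum_mul, ENNReal.ofReal_sum_of_nonneg]
            intro B _
            exact mul_nonneg (rB_nonneg _ _ _) (Real.exp_pos _).le
        _ ≤ _ := by
            gcongr
            exact rB_sum hβ h v Q (fun A hA => (hQ A hA).2)

end PartTwo

noncomputable section PartThree
open scoped Classical

/-- configurations with prescribed down contours, zeros required in `T` -/
def DD (V : Finset Site) (h : ℤ) (M T : Finset (Finset Site)) : Set (Site → ℤ) :=
  {φ | φ ∈ Pl V h ∧ (∀ A ∈ M, crossOK A h h φ) ∧ ∀ A ∈ T, ∃ x ∈ A, φ x = 0}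

lemma crossOK_iff {B : Finset Site} {c' c : ℤ} {ψ : Site → ℤ} : crossOK B c' c ψ ↔
    (∀ x ∈ innerBdry B, ψ x ≤ c') ∧ outGe B c ψ := by
  constructor
  · intro h
    constructor
    · intro x hx
      obtain ⟨hxB, e, he, hxe⟩ := mem_innerBdry.1 hx
      have he' := mem_bdE.1 he
      rcases hxe with rfl | rfl
      · exact ((h e he).1 hxB).1
      · exact ((h e he).2 (by tauto)).1
    · intro e he
      have he' := mem_bdE.1 he
      exact ⟨fun h1 => ((h e he).2 h1).2, fun h1 => ((h e he).1 (by tauto)).2⟩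
  · rintro ⟨h1, h2⟩
    exact cross_of h1 h2

lemma DD_step {β lam : ℝ} (hβ : 100 ≤ β) (hl : 0 < lam) (h : ℕ)
    (hlam : lam ≤ Real.exp (-4 * β * h - β)) {V L0 : Finset Site} {M T : Finset (Finset Site)}
    (hM0 : M ⊆ outer L0) (hsub : ∀ A ∈ M, A ⊆ V) (hInterior : ∀ A ∈ M, ∀ x ∈ A, x ∉ innerBdry V)
    (hT : T ⊆ M) {A : Finset Site} (hA : A ∈ M) (hAT : A ∉ T) :
    ZZ β lam V (DD V h M (insert A T)) ≤
      ((A.card : ENNReal) * ENNReal.ofReal (4 * Real.exp (-4 * β * h))) *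
        ZZ β lam V (DD V h M T) := by
  have hAV := hsub A hA
  have hAC := outer_contC (hM0 hA)
  set Ko : Set (Site → ℤ) := {g | g ∈ DD V h M T ∧ ∀ x ∈ A, g x = h} with hKo
  have hglue : ∀ Kin : Set (Site → ℤ), Kin ⊆ Mi A h →
      ZZ β lam V {ψ | gIn A h ψ ∈ Kin ∧ gOut A h ψ ∈ Ko} =
      ex (lam * (h : ℤ) * A.card - β * ((h : ℤ) - (h : ℤ)) * (bdE A).card) *
        (ZZ β lam A Kin * ZZ β lam V Ko) := by
    intro Kin hKin
    apply ZZ_glue hAV le_rfl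
    · intro f hf x hx
      exact (mem_Mi.1 (hKin hf)).1 x hx
    · intro g hg x hx
      exact hg.2 x hx
    · intro ψ h1 h2
      apply cross_of
      · intro x hx
        have h3 := (mem_Mi.1 (hKin h1)).2.2 x hx
        have : x ∈ A := (mem_innerBdry.1 hx).1
        simpa [gIn, this] using h3
      · exact outGe_gOut.1 (crossOK_iff.1 (h2.1.2.1 A hA)).2
  have hdisj : ∀ A' ∈ M, A' ≠ A → ∀ x ∈ A', x ∉ A := by
    intro A' hA' hne x hx hxA
    exact Finset.disjoint_left.1 (outer_disj (hM0 hA') (hM0 hA) hne) hx hxA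
  have hfwd : DD V h M (insert A T) ⊆
      {ψ | gIn A h ψ ∈ Mi A h ∩ {f | ∃ x ∈ A, f x = 0} ∧ gOut A h ψ ∈ Ko} := by
    rintro ψ ⟨h1, h2, h3⟩
    rw [mem_Pl] at h1
    have hcA := crossOK_iff.1 (h2 A hA)
    refine ⟨⟨?_, ?_⟩, ⟨?_, ?_, ?_⟩, ?_⟩
    · rw [mem_Mi]
      refine ⟨fun x hx => by simp [gIn, hx], fun x hx => ?_, fun x hx => ?_⟩
      · simp only [gIn, hx, if_true]
        exact h1.2.1 x (hAV hx)
      · have hxA := (mem_innerBdry.1 hx).1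
        simp only [gIn, hxA, if_true]
        exact hcA.1 x hx
    · obtain ⟨x, hx, hx0⟩ := h3 A (Finset.mem_insert_self _ _)
      exact ⟨x, hx, by simp [gIn, hx, hx0]⟩
    · rw [mem_Pl]
      refine ⟨fun x hx => ?_, fun x hx => ?_, fun x hx => ?_⟩
      · have : x ∉ A := fun h => hx (hAV h)
        simp only [gOut, this, if_false]
        exact h1.1 x hx
      · unfold gOut
        split_ifs
        · positivity
        · exact h1.2.1 x hx
      · unfold gOut
        split_ifs
        · exact le_rfl
        · exact h1.2.2 x hx
    · intro A' hA'
      by_cases hne : A' = A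
      · subst hne
        rw [crossOK_iff, outGe_gOut]
        refine ⟨fun x hx => ?_, hcA.2⟩
        have hxA := (mem_innerBdry.1 hx).1
        simp [gOut, hxA]
      · have hc' := crossOK_iff.1 (h2 A' hA')
        rw [crossOK_iff]
        refine ⟨fun x hx => ?_, fun e he => ⟨fun hx => ?_, fun hx => ?_⟩⟩
        · have hxA := hdisj A' hA' hne x (mem_innerBdry.1 hx).1
          simp only [gOut, hxA, if_false]
          exact hc'.1 x hx
        · unfold gOut
          split_ifs
          · exact le_rfl
          · exact (hc'.2 e he).1 hx
        · unfold gOut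
          split_ifs
          · exact le_rfl
          · exact (hc'.2 e he).2 hx
    · intro A' hA'
      obtain ⟨x, hx, hx0⟩ := h3 A' (Finset.mem_insert_of_mem hA')
      have hne : A' ≠ A := by rintro rfl; exact hAT hA'
      have hxA := hdisj A' (hT hA') hne x hx
      exact ⟨x, hx, by simp [gOut, hxA, hx0]⟩
    · intro x hx
      simp [gOut, hx]
  have hbwd : {ψ | gIn A h ψ ∈ Mi A h ∧ gOut A h ψ ∈ Ko} ⊆ DD V h M T := by
    rintro ψ ⟨h1, ⟨h2, h3, h4⟩, _⟩
    rw [mem_Mi] at h1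
    rw [mem_Pl] at h2
    refine ⟨?_, ?_, ?_⟩
    · rw [mem_Pl]
      refine ⟨fun x hx => ?_, fun x hx => ?_, fun x hx => ?_⟩
      · have : x ∉ A := fun h => hx (hAV h)
        have := h2.1 x hx
        simpa [gOut, *] using this
      · by_cases hxA : x ∈ A
        · have := h1.2.1 x hxA
          simpa [gIn, hxA] using this
        · have := h2.2.1 x hx
          simpa [gOut, hxA] using this
      · have hxA : x ∉ A := fun h => hInterior A hA x h hx
        have := h2.2.2 x hx
        simpa [gOut, hxA] using this
    · intro A' hA'
      by_cases hne : A' = A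
      · subst hne
        rw [crossOK_iff]
        refine ⟨fun x hx => ?_, outGe_gOut.1 (crossOK_iff.1 (h3 A' hA')).2⟩
        have hxA := (mem_innerBdry.1 hx).1
        have := h1.2.2 x hx
        simpa [gIn, hxA] using this
      · have hc' := crossOK_iff.1 (h3 A' hA')
        rw [crossOK_iff]
        refine ⟨fun x hx => ?_, fun e he => ?_⟩
        · have hxA := hdisj A' hA' hne x (mem_innerBdry.1 hx).1
          have := hc'.1 x hx
          simpa [gOut, hxA] using this
        · have he' := mem_bdE.1 he
          have hnot : e ∉ bdE A := fun h =>
            Finset.disjoint_left.1 (outer_bdE_disj (hM0 hA') (hM0 hA) hne) he h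
          rw [mem_bdE, not_not] at hnot
          constructor
          · intro hx
            have h5 : eHead e ∈ A' := by tauto
            have h6 : eHead e ∉ A := hdisj A' hA' hne _ h5
            have h7 : e.1 ∉ A := by tauto
            have := (hc'.2 e he).1 hx
            simpa [gOut, h7] using this
          · intro hx
            have h5 : e.1 ∈ A' := by tauto
            have h6 : e.1 ∉ A := hdisj A' hA' hne _ h5
            have h7 : eHead e ∉ A := by tauto
            have := (hc'.2 e he).2 hx
            simpa [gOut, h7] using this
    · intro A' hA'
      obtain ⟨x, hx, hx0⟩ := h4 A' hA'
      have hne : A' ≠ A := by rintro rfl; exact hAT hA'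
      have hxA := hdisj A' (hT hA') hne x hx
      exact ⟨x, hx, by simpa [gOut, hxA] using hx0⟩
  have hin : ZZ β lam A (Mi A h ∩ {f | ∃ x ∈ A, f x = 0}) ≤
      ((A.card : ENNReal) * ENNReal.ofReal (4 * Real.exp (-4 * β * h))) *
        ZZ β lam A (Mi A h) := by
    refine (ZZ_le_sum A _ (fun x => Mi A h ∩ {f | f x = 0}) ?_).trans ?_
    · rintro f ⟨h1, x, hx, hx0⟩
      exact ⟨x, hx, h1, hx0⟩
    · refine (Finset.sum_le_sum (fun x hx => partTwo hβ hl h hlam (good_of_contC hAC) x hx)).trans ?_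
      rw [Finset.sum_const, nsmul_eq_mul, ← mul_assoc]
  refine (ZZ_mono hfwd).trans ?_
  rw [hglue _ Set.inter_subset_left]
  have hb := ZZ_mono (β := β) (lam := lam) (V := V) hbwd
  rw [hglue _ (Set.Subset.refl _)] at hb
  set κ := ex (lam * (h : ℤ) * A.card - β * ((h : ℤ) - (h : ℤ)) * (bdE A).card)
  calc _ ≤ κ * ((((A.card : ENNReal) * ENNReal.ofReal (4 * Real.exp (-4 * β * h))) *
        ZZ β lam A (Mi A h)) * ZZ β lam V Ko) := by gcongr
    _ = ((A.card : ENNReal) * ENNReal.ofReal (4 * Real.exp (-4 * β * h))) *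
        (κ * (ZZ β lam A (Mi A h) * ZZ β lam V Ko)) := by ring
    _ ≤ _ := by gcongr

lemma DD_bound {β lam : ℝ} (hβ : 100 ≤ β) (hl : 0 < lam) (h : ℕ)
    (hlam : lam ≤ Real.exp (-4 * β * h - β)) {V L0 : Finset Site} {M : Finset (Finset Site)}
    (hM0 : M ⊆ outer L0) (hsub : ∀ A ∈ M, A ⊆ V) (hInterior : ∀ A ∈ M, ∀ x ∈ A, x ∉ innerBdry V)
    (T : Finset (Finset Site)) (hT : T ⊆ M) :
    ZZ β lam V (DD V h M T) ≤
      (∏ A ∈ T, ((A.card : ENNReal) * ENNReal.ofReal (4 * Real.exp (-4 * β * h)))) *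
        ZZ β lam V (Pl V h) := by
  induction T using Finset.induction_on with
  | empty =>
    rw [Finset.prod_empty, one_mul]
    exact ZZ_mono (fun φ hφ => hφ.1)
  | insert A T hAT ih =>
    have hT' : T ⊆ M := fun x hx => hT (Finset.mem_insert_of_mem hx)
    refine (DD_step hβ hl h hlam hM0 hsub hInterior hT' (hT (Finset.mem_insert_self _ _)) hAT).trans ?_
    rw [Finset.prod_insert hAT, mul_assoc _ _ (ZZ β lam V (Pl V h))]
    gcongr
    exact ih hT'

/-- low level set -/
def llev (V : Finset Site) (k : ℤ) (ψ : Site → ℤ) : Finset Site := V.filter fun v => ψ v ≤ k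

/-- outer contours of the low set containing a zero -/
def MM (V : Finset Site) (k : ℤ) (ψ : Site → ℤ) : Finset (Finset Site) :=
  (outer (llev V k ψ)).filter fun A => ∃ x ∈ A, ψ x = 0

/-- lowering off a set -/
def lowerOff (U : Finset Site) (ψ : Site → ℤ) : Site → ℤ := fun x => if x ∈ U then ψ x else ψ x - 1

lemma lowerOff_inj (U : Finset Site) : Function.Injective (lowerOff U) := by
  intro ψ φ h
  funext x
  have := congrFun h x
  unfold lowerOff at this
  split_ifs at this <;> omega

lemma Fl_lowerOff (U V : Finset Site) (ψ : Site → ℤ) :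
    Fl V ψ = Fl V (lowerOff U ψ) + (V \ U).card := by
  have : ∀ v ∈ V, ψ v = lowerOff U ψ v + if v ∉ U then 1 else 0 := by
    intro v _
    unfold lowerOff
    split_ifs <;> first | omega | tauto
  rw [Fl, Finset.sum_congr rfl this, Finset.sum_add_distrib, Fl, ← Finset.sum_filter,
    Finset.sum_const, nsmul_eq_mul, mul_one]
  congr 3
  ext x; simp

lemma Pl_fiber {β lam : ℝ} (hβ : 100 ≤ β) (hl : 0 < lam) (h : ℕ)
    (hlam : lam ≤ Real.exp (-4 * β * h - β)) {V : Finset Site} (hV : Good V)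
    (M : Finset (Finset Site)) :
    ZZ β lam V (Pl V ((h + 1 : ℕ) : ℤ) ∩ {ψ | MM V h ψ = M}) ≤
      ((∏ A ∈ M, ENNReal.ofReal (4 * Real.exp (-4 * β * h) *
        (A.card * Real.exp (-β * (bdE A).card)))) * ex (-lam) ^ (V \ uni M).card) *
        ZZ β lam V (Pl V h) := by
  rcases Set.eq_empty_or_nonempty (Pl V ((h + 1 : ℕ) : ℤ) ∩ {ψ | MM V h ψ = M}) with he | hne
  · rw [he]
    simp [ZZ]
  obtain ⟨ψ0, hψ0, hM0⟩ := hne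
  simp only [Set.mem_setOf_eq] at hM0
  have hgen : ∀ ψ, MM V h ψ = M → M ⊆ outer (llev V h ψ) := by
    intro ψ hψ
    rw [← hψ]
    exact Finset.filter_subset _ _
  have hLV : ∀ ψ, llev V h ψ ⊆ V := fun ψ => Finset.filter_subset _ _
  have hMo := hgen ψ0 hM0
  have hsub : ∀ A ∈ M, A ⊆ V := fun A hA => outer_sub hV (hLV ψ0) (hMo hA)
  have hU : uni M ⊆ V := uni_sub hV (hLV ψ0) hMo
  have hInterior : ∀ A ∈ M, ∀ x ∈ A, x ∉ innerBdry V := by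
    intro A hA x hxA hx
    obtain ⟨_, e, he, hxe⟩ := mem_innerBdry.1 (innerBdry_mono (hsub A hA) hx hxA)
    have ho := outer_orient (hMo hA) he
    have hxL : x ∈ llev V h ψ0 := by
      rcases hxe with rfl | rfl
      · exact ho.1.1 hxA
      · exact ho.2.1 hxA
    simp only [llev, Finset.mem_filter] at hxL
    have := (mem_Pl.1 hψ0).2.2 x hx
    push_cast at this
    omega
  have hmap : ZZ β lam V (Pl V ((h + 1 : ℕ) : ℤ) ∩ {ψ | MM V h ψ = M}) ≤
      ex (-(β * (bdE (uni M)).card + lam * (V \ uni M).card)) * ZZ β lam V (DD V h M M) := by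
    apply ZZ_le_of_map _ (lowerOff (uni M)) ((lowerOff_inj _).injOn)
    · rintro ψ ⟨h1, h2⟩
      simp only [Set.mem_setOf_eq] at h2
      have hMψ := hgen ψ h2
      rw [mem_Pl] at h1
      have hout : ∀ x, x ∉ llev V h ψ → (h : ℤ) + 1 ≤ ψ x := by
        intro x hx
        by_cases hxV : x ∈ V
        · simp only [llev, Finset.mem_filter, not_and, not_le] at hx
          have := hx hxV
          omega
        · rw [h1.1 x hxV]; push_cast; exact le_rfl
      have hinn : ∀ x, x ∈ llev V h ψ → ψ x ≤ h := by
        intro x hx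
        simp only [llev, Finset.mem_filter] at hx
        exact hx.2
      refine ⟨?_, ?_, ?_⟩
      · rw [mem_Pl]
        refine ⟨fun x hx => ?_, fun x hx => ?_, fun x hx => ?_⟩
        · have : x ∉ uni M := fun h => hx (hU h)
          simp only [lowerOff, this, if_false]
          rw [h1.1 x hx]; push_cast; ring
        · have h0 := h1.2.1 x hx
          by_cases hxU : x ∈ uni M
          · simp only [lowerOff, hxU, if_true]; exact h0
          · simp only [lowerOff, hxU, if_false]
            by_contra hneg
            have hx0 : ψ x = 0 := by omega
            have hxL : x ∈ llev V h ψ := by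
              simp only [llev, Finset.mem_filter, hx0]
              exact ⟨hx, by positivity⟩
            obtain ⟨A, hA, hxA⟩ := outer_cover hxL
            apply hxU
            refine mem_uni.2 ⟨A, ?_, hxA⟩
            rw [← h2, MM, Finset.mem_filter]
            exact ⟨hA, x, hxA, hx0⟩
        · have := h1.2.2 x hx
          push_cast at this
          unfold lowerOff
          split_ifs <;> omega
      · intro A hA e he
        have ho := outer_orient (hMψ hA) he
        have heU : e ∈ bdE (uni M) := (mem_bdE_uni hMψ).2 ⟨A, hA, he⟩
        have hoU := uni_orient hMψ heU
        have he' := mem_bdE.1 he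
        constructor
        · intro a
          have b : eHead e ∉ A := by tauto
          have a1 : e.1 ∈ uni M := by tauto
          have b1 : eHead e ∉ uni M := by tauto
          have a2 := hinn e.1 (by tauto)
          have b2 := hout (eHead e) (by tauto)
          simp only [lowerOff, a1, b1, if_true, if_false]
          omega
        · intro a
          have b : eHead e ∈ A := by tauto
          have a1 : e.1 ∉ uni M := by tauto
          have b1 : eHead e ∈ uni M := by tauto
          have a2 := hout e.1 (by tauto)
          have b2 := hinn (eHead e) (by tauto)
          simp only [lowerOff, a1, b1, if_true, if_false]
          omega
      · intro A hA
        have hA' := hA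
        rw [← h2, MM, Finset.mem_filter] at hA'
        obtain ⟨_, x, hx, hx0⟩ := hA'
        have : x ∈ uni M := mem_uni.2 ⟨A, hA, hx⟩
        exact ⟨x, hx, by simp [lowerOff, this, hx0]⟩
    · rintro ψ ⟨h1, h2⟩
      simp only [Set.mem_setOf_eq] at h2
      have hMψ := hgen ψ h2
      rw [mem_Pl] at h1
      have hout : ∀ x, x ∉ llev V h ψ → (h : ℤ) + 1 ≤ ψ x := by
        intro x hx
        by_cases hxV : x ∈ V
        · simp only [llev, Finset.mem_filter, not_and, not_le] at hx
          have := hx hxV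
          omega
        · rw [h1.1 x hxV]; push_cast; exact le_rfl
      have hinn : ∀ x, x ∈ llev V h ψ → ψ x ≤ h := by
        intro x hx
        simp only [llev, Finset.mem_filter] at hx
        exact hx.2
      apply wt_mono
      have hE : En V ψ = En V (lowerOff (uni M) ψ) + (bdE (uni M)).card := by
        apply En_shift hU
        intro e _
        by_cases he : e ∈ bdE (uni M)
        · have ho := uni_orient hMψ he
          have he' := mem_bdE.1 he
          by_cases a : e.1 ∈ uni M <;> by_cases b : eHead e ∈ uni M
          · tauto
          · have := hinn _ (ho.1.1 a)
            have := hout _ (fun h => b (ho.2.2 h))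
            simp only [he, lowerOff, a, b, if_true, if_false]
            rw [abs_of_nonpos (by omega), abs_of_nonpos (by omega)]; ring
          · have := hinn _ (ho.2.1 b)
            have := hout _ (fun h => a (ho.1.2 h))
            simp only [he, lowerOff, a, b, if_true, if_false]
            rw [abs_of_nonneg (by omega), abs_of_nonneg (by omega)]; ring
          · tauto
        · have he' := he
          rw [mem_bdE] at he'
          push Not at he'
          by_cases a : e.1 ∈ uni M <;> by_cases b : eHead e ∈ uni M <;>
            simp [lowerOff, a, b, he] <;> tauto
      rw [hE, Fl_lowerOff (uni M) V ψ]
      push_cast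
      linarith
  refine hmap.trans ?_
  refine (mul_le_mul_right (DD_bound hβ hl h hlam hMo hsub hInterior M (Finset.Subset.refl _)) _).trans
    (le_of_eq ?_)
  rw [← mul_assoc]
  congr 1
  have e1 : ex (-(β * (bdE (uni M)).card + lam * (V \ uni M).card)) =
      (∏ A ∈ M, ex (-β * (bdE A).card)) * ex (-lam) ^ (V \ uni M).card := by
    rw [← ex_sum, ← ex_nat_mul, ← ex_add, card_bdE_uni hMo, ← Finset.mul_sum]
    congr 1
    push_cast
    ring
  rw [e1, mul_assoc, mul_comm (ex (-lam) ^ _), ← mul_assoc, ← Finset.prod_mul_distrib]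
  congr 1
  apply Finset.prod_congr rfl
  intro A _
  rw [ENNReal.ofReal_mul (by positivity : (0 : ℝ) ≤ 4 * Real.exp (-4 * β * h)),
    ENNReal.ofReal_mul (by positivity : (0 : ℝ) ≤ A.card),
    ENNReal.ofReal_natCast]
  unfold ex
  ring

theorem partThree {β lam : ℝ} (hβ : 100 ≤ β) (hl : 0 < lam) (hl1 : lam ≤ 1) (h : ℕ)
    (hlam0 : Real.exp (-4 * β * h - 2 * β) ≤ lam)
    (hlam : lam ≤ Real.exp (-4 * β * h - β)) {V : Finset Site} (hV : Good V) :
    ZZ β lam V (Pl V ((h + 1 : ℕ) : ℤ)) ≤ ZZ β lam V (Pl V h) := by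
  have hsum := ZZ_le_sum (β := β) (lam := lam) (V := V) (fam (QQ V) V)
    (Pl V ((h + 1 : ℕ) : ℤ)) (fun M => Pl V ((h + 1 : ℕ) : ℤ) ∩ {ψ | MM V h ψ = M})
    (fun ψ hψ => ⟨MM V h ψ, outer_powerset_fam hV (Finset.filter_subset _ _)
      (Finset.filter_subset _ _), hψ, rfl⟩)
  refine hsum.trans ((Finset.sum_le_sum (fun M _ => Pl_fiber hβ hl h hlam hV M)).trans ?_)
  rw [← Finset.sum_mul]
  refine (mul_le_mul_left (Xi_le_one (QQ V) (fun A => ENNReal.ofReal (4 * Real.exp (-4 * β * h) *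
        (A.card * Real.exp (-β * (bdE A).card)))) (ex (-lam)) ?_ ?_ V) _).trans
        (le_of_eq (one_mul _))
  · intro A hA
    simp only [QQ, Finset.mem_filter] at hA
    exact hA.2.1
  · intro x
    rw [← ENNReal.ofReal_sum_of_nonneg (fun A _ => by positivity), ← Finset.mul_sum]
    calc _ ≤ ENNReal.ofReal (1 - lam / 2) + ENNReal.ofReal (4 * Real.exp (-4 * β * h) *
          (Real.exp (-2 * β) / 8)) := by
            gcongr
            · exact ENNReal.ofReal_le_ofReal (exp_neg_le hl.le hl1)
            · apply count_four hβ x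
              intro A hA
              simp only [QQ, Finset.mem_filter] at hA
              exact ⟨hA.1.2, hA.2⟩
      _ ≤ 1 := by
            rw [← ENNReal.ofReal_add (by linarith) (by positivity), ← ENNReal.ofReal_one]
            apply ENNReal.ofReal_le_ofReal
            have : Real.exp (-4 * β * h - 2 * β) = Real.exp (-4 * β * h) * Real.exp (-2 * β) := by
              rw [← Real.exp_add]; congr 1; ring
            linarith

theorem wrn_bound {β lam : ℝ} (hβ : 100 ≤ β) (hl : 0 < lam) (hl1 : lam ≤ 1) (h : ℕ)
    (hlam0 : Real.exp (-4 * β * h - 2 * β) ≤ lam)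
    (hlam : lam ≤ Real.exp (-4 * β * h - β)) (γ : Contour) (hγ : γ.valid) :
    Wrn β lam (h : ℤ) γ ≤ Real.exp (-(β - 4) * (γ.len : ℝ)) := by
  have hV : Good γ.int := good_of_conn hγ.2.2
  have hexp : Real.exp (-β * (γ.len : ℝ)) ≤ Real.exp (-(β - 4) * (γ.len : ℝ)) := by
    apply Real.exp_le_exp.2
    have : (0 : ℝ) ≤ γ.len := Nat.cast_nonneg _
    nlinarith
  unfold Wrn
  split_ifs
  · refine le_trans (mul_le_of_le_one_right (Real.exp_pos _).le ?_) hexp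
    rw [Zsos_eq_ZZ, Zsos_eq_ZZ]
    apply ratio_le_one
    have := partThree hβ hl hl1 h hlam0 hlam hV
    push_cast at this
    exact this
  · refine le_trans (mul_le_of_le_one_right (Real.exp_pos _).le ?_) hexp
    rw [Zsos_eq_ZZ, Zsos_eq_ZZ]
    apply ratio_le_one
    cases h with
    | zero =>
      have : signedConfigs γ.int (constSign .minus) (((0 : ℕ) : ℤ) - 1) = ∅ := by
        rw [Set.eq_empty_iff_forall_notMem]
        intro ψ hψ
        obtain ⟨x, hx⟩ := innerBdry_nonempty hγ.1
        have h1 := mem_Mi.1 hψ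
        have h2 := h1.2.1 x (mem_innerBdry.1 hx).1
        have h3 := h1.2.2 x hx
        push_cast at h3
        omega
      rw [this]
      simp [ZZ]
    | succ k =>
      have := partOne hβ hl k hlam hV
      have e : ((k + 1 : ℕ) : ℤ) - 1 = k := by push_cast; ring
      rw [e]
      exact this

end PartThree

/-- Lemma 4.1 of the paper. There is an absolute `β₀` such that for
`β > β₀` and `0 < λ ≤ 1`: if `λ ∈ I_h = [e^{-4βh-2β}, e^{-4βh-β}]` then every
(not necessarily `h`-elementary) contour `γ` satisfies `W^rn_h(γ) ≤ e^{-(β-4)|γ|}`. -/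
theorem statement10 :
    ∃ β₀ : ℝ, ∀ β : ℝ, β₀ < β → ∀ lam : ℝ, 0 < lam → lam ≤ 1 → ∀ h : ℕ,
      Real.exp (-4 * β * (h : ℝ) - 2 * β) ≤ lam →
      lam ≤ Real.exp (-4 * β * (h : ℝ) - β) →
      ∀ γ : Contour, Contour.valid γ →
        Wrn β lam (h : ℤ) γ ≤ Real.exp (-(β - 4) * (γ.len : ℝ)) := by
  exact ⟨100, fun β hβ lam hl hl1 h h0 h1 γ hγ => wrn_bound hβ.le hl hl1 h h0 h1 γ hγ⟩
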